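/- arXiv:math/0503750 — 7 statements merged into one kernel-verified Lean document; each statement's English description precedes it below -/
import Mathlib

section
/- Let D ⊆ ℂⁿ be open and f : ℂ × D → ℂ holomorphic with f(0,w) ≠ 0 for all w ∈ D, and suppose there is λ ≥ 0 such that for every w ∈ D the entire function z ↦ f(z,w) has order at most λ. For each natural number p > λ define F_p(w) as the p-th derivative at z = 0 of the function z ↦ (∂f/∂z)(z,w)/f(z,w) (which is analytic in z near 0 since f(0,w) ≠ 0). Then each F_p is holomorphic on D, and for every w ∈ D one has (∀ z ∈ ℂ, f(z,w) ≠ 0) if and only if F_p(w) = 0 for every natural number p > λ. -/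
open Filter Topology Metric

/-- A zero-free entire function has an entire logarithm. -/
theorem Complex.exists_exp_eq {g : ℂ → ℂ} (hg : Differentiable ℂ g)
    (hg0 : ∀ z, g z ≠ 0) :
    ∃ h : ℂ → ℂ, (∀ z, HasDerivAt h (deriv g z / g z) z) ∧ ∀ z, Complex.exp (h z) = g z := by
  have hg' : Differentiable ℂ (deriv g) := fun z => (hg.analyticAt z).deriv.differentiableAt
  have hq : Differentiable ℂ (fun z => deriv g z / g z) := hg'.div hg hg0
  obtain ⟨h, hh0, hh⟩ := hq.isExactOn_univ.with_val_at 0 (Complex.log (g 0))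
  have hh : ∀ z, HasDerivAt h (deriv g z / g z) z := fun z => hh z (Set.mem_univ z)
  refine ⟨h, hh, fun z => ?_⟩
  have hder : ∀ z, HasDerivAt (fun z => Complex.exp (h z) / g z) 0 z := fun z => by
    have hgz := hg0 z
    convert! ((hh z).cexp.div (hg z).hasDerivAt hgz) using 1
    field_simp
    ring
  have hconst := is_const_of_deriv_eq_zero (fun z => (hder z).differentiableAt)
    (fun z => (hder z).deriv) z 0
  rw [hh0, Complex.exp_log (hg0 0), div_self (hg0 0)] at hconst
  exact (div_eq_one_iff_eq (hg0 z)).1 hconst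

/-- If the real part of an entire function grows at most like `‖z‖ ^ r`, then its derivatives
at `0` of order larger than `r` vanish. -/
theorem Complex.iteratedDeriv_eq_zero_of_re_le {h : ℂ → ℂ} (hh : Differentiable ℂ h)
    {r A B : ℝ} (hr : 0 ≤ r) (hA : 0 < A) (hB : 0 ≤ B)
    (hre : ∀ z, (h z).re ≤ A + B * ‖z‖ ^ r) {p : ℕ} (hp : r < p) :
    iteratedDeriv p h 0 = 0 := by
  have hbound : ∀ R : ℝ, 0 < R → ‖iteratedDeriv p h 0‖ ≤
      p.factorial * ((2 * A + 3 * ‖h 0‖) * R ^ (-(p : ℝ)) +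
        2 * B * 2 ^ r * R ^ (-((p : ℝ) - r))) := by
    intro R hR
    have hM : 0 < A + B * (2 * R) ^ r := by positivity
    have hC : ∀ z ∈ sphere (0 : ℂ) R, ‖h z‖ ≤ 2 * (A + B * (2 * R) ^ r) + 3 * ‖h 0‖ := by
      intro z hz
      have hzR : ‖z‖ = R := mem_sphere_zero_iff_norm.1 hz
      have key := Complex.borelCaratheodory (f := h) (R := 2 * R) (z := z) hM
        hh.differentiableOn ?_ (by positivity) ?_
      · rw [hzR] at key
        refine key.trans (le_of_eq ?_)
        rw [show 2 * R - R = R by ring]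
        field_simp
        ring
      · intro x hx
        refine (hre x).trans ?_
        have : ‖x‖ ≤ 2 * R := (mem_ball_zero_iff.1 hx).le
        gcongr
      · rw [mem_ball_zero_iff, hzR]
        linarith
    refine (Complex.norm_iteratedDeriv_le_of_forall_mem_sphere_norm_le p hR hh.diffContOnCl
      hC).trans (le_of_eq ?_)
    rw [Real.mul_rpow (by norm_num) hR.le, neg_sub, Real.rpow_sub hR, Real.rpow_neg hR.le,
      Real.rpow_natCast]
    field_simp
    ring
  have hlim : Tendsto (fun R : ℝ => p.factorial * ((2 * A + 3 * ‖h 0‖) * R ^ (-(p : ℝ)) +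
        2 * B * 2 ^ r * R ^ (-((p : ℝ) - r)))) atTop (𝓝 0) := by
    have h1 := tendsto_rpow_neg_atTop (lt_of_le_of_lt hr hp)
    have h2 := tendsto_rpow_neg_atTop (sub_pos.2 hp)
    simpa using ((h1.const_mul (2 * A + 3 * ‖h 0‖)).add
      (h2.const_mul (2 * B * 2 ^ r))).const_mul (p.factorial : ℝ)
  have := ge_of_tendsto hlim ((eventually_gt_atTop 0).mono hbound)
  exact norm_le_zero_iff.1 this

/-- The derivatives at `0` of order larger than `r` of the logarithmic derivative of a zero-free
entire function of order at most `r` vanish. -/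
theorem Complex.iteratedDeriv_logDeriv_eq_zero {g : ℂ → ℂ} (hg : Differentiable ℂ g)
    (hg0 : ∀ z, g z ≠ 0) {r C : ℝ} (hr : 0 ≤ r) (hC : 0 < C)
    (hord : ∀ z, ‖g z‖ ≤ C * Real.exp (C * ‖z‖ ^ r)) {p : ℕ} (hp : r < p) :
    iteratedDeriv p (fun z => deriv g z / g z) 0 = 0 := by
  obtain ⟨h, hh, hexp⟩ := Complex.exists_exp_eq hg hg0
  have hderiv : (fun z => deriv g z / g z) = deriv h := funext fun z => (hh z).deriv.symm
  rw [hderiv, ← iteratedDeriv_succ']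
  refine Complex.iteratedDeriv_eq_zero_of_re_le (fun z => (hh z).differentiableAt)
    (A := C) (B := C) hr hC hC.le (fun z => ?_) (by push_cast; linarith)
  have h1 := hord z
  rw [← hexp z, Complex.norm_exp] at h1
  have h2 : C ≤ Real.exp C := by linarith [Real.add_one_le_exp C]
  rw [← Real.exp_le_exp, Real.exp_add]
  exact h1.trans (by gcongr)

/-- If almost all derivatives at `0` of the logarithmic derivative of an entire function vanish,
then this function has no zeros. -/
theorem Complex.ne_zero_of_iteratedDeriv_logDeriv_eq_zero {g : ℂ → ℂ}
    (hg : Differentiable ℂ g) (hg0 : g 0 ≠ 0) {N : ℕ}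
    (hN : ∀ p, N ≤ p → iteratedDeriv p (fun z => deriv g z / g z) 0 = 0) (z : ℂ) :
    g z ≠ 0 := by
  set q : ℂ → ℂ := fun z => deriv g z / g z with hq
  have hg' : Differentiable ℂ (deriv g) := fun z => (hg.analyticAt z).deriv.differentiableAt
  obtain ⟨ε, hε, hball⟩ := Metric.eventually_nhds_iff_ball.1
    (hg.continuous.continuousAt.eventually_ne hg0)
  have hqd : DifferentiableOn ℂ q (ball 0 ε) :=
    hg'.differentiableOn.div hg.differentiableOn hball
  set Q : ℂ → ℂ := fun z => ∑ i ∈ Finset.range N,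
    (i.factorial : ℂ)⁻¹ • (z - 0) ^ i • iteratedDeriv i q 0 with hQ
  have hqQ : ∀ z ∈ ball (0 : ℂ) ε, q z = Q z := fun z hz =>
    (Complex.hasSum_taylorSeries_on_ball hqd hz).unique
      (hasSum_sum_of_ne_finset_zero fun i hi => by
        rw [hN i (by simpa using hi), smul_zero, smul_zero])
  have hQd : Differentiable ℂ Q := by
    rw [hQ]
    fun_prop
  obtain ⟨P, hP⟩ := hQd.isExactOn_univ
  have hP : ∀ z, HasDerivAt P (Q z) z := fun z => hP z (Set.mem_univ z)
  have hode : deriv g = fun z => Q z * g z := by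
    refine AnalyticOnNhd.eq_of_eventuallyEq (z₀ := 0) (fun z _ => hg'.analyticAt z)
      (fun z _ => (hQd.mul hg).analyticAt z) ?_
    filter_upwards [ball_mem_nhds (0 : ℂ) hε] with z hz
    rw [← hqQ z hz]
    exact (div_mul_cancel₀ _ (hball z hz)).symm
  have hder : ∀ z, HasDerivAt (fun z => g z * Complex.exp (-P z)) 0 z := fun z => by
    convert! (hg z).hasDerivAt.mul (hP z).neg.cexp using 1
    rw [hode]
    ring
  have hconst := is_const_of_deriv_eq_zero (fun z => (hder z).differentiableAt)
    (fun z => (hder z).deriv) z 0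
  intro hz
  rw [hz, zero_mul] at hconst
  exact mul_ne_zero hg0 (Complex.exp_ne_zero _) hconst.symm

/-- The iterated partial derivatives in the first variable of an analytic function are analytic
in both variables. -/
theorem AnalyticOnNhd.exists_iteratedDeriv_fst {E : Type*} [NormedAddCommGroup E]
    [NormedSpace ℂ E] {G : ℂ × E → ℂ} {U : Set (ℂ × E)} (hU : IsOpen U)
    (hG : AnalyticOnNhd ℂ G U) (p : ℕ) :
    ∃ H : ℂ × E → ℂ, AnalyticOnNhd ℂ H U ∧
      ∀ x ∈ U, iteratedDeriv p (fun z => G (z, x.2)) x.1 = H x := by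
  induction p with
  | zero => exact ⟨G, hG, fun x _ => by simp⟩
  | succ p ih =>
    obtain ⟨H, hH, hGH⟩ := ih
    refine ⟨fun x => fderiv ℂ H x (1, 0), fun x hx =>
      ((ContinuousLinearMap.apply ℂ ℂ ((1, 0) : ℂ × E)).analyticAt _).comp (hH.fderiv x hx),
      fun x hx => ?_⟩
    have hcont : Continuous fun z : ℂ => (z, x.2) := by fun_prop
    have hev : iteratedDeriv p (fun z => G (z, x.2)) =ᶠ[𝓝 x.1] fun z => H (z, x.2) := by
      filter_upwards [hcont.continuousAt.eventually (hU.mem_nhds hx)] with z hz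
      exact hGH (z, x.2) hz
    rw [iteratedDeriv_succ, hev.deriv_eq]
    have h1 : HasDerivAt (fun z : ℂ => (z, x.2)) (1, 0) x.1 :=
      (hasDerivAt_id x.1).prodMk (hasDerivAt_const x.1 x.2)
    exact ((hH x hx).differentiableAt.hasFDerivAt.comp_hasDerivAt x.1 h1).deriv


/-- Lelong's functions `F_p`: for `f : ℂ × D → ℂ` holomorphic, `D ⊆ ℂⁿ` open,
`f (0, w) ≠ 0` on `D`, and all the entire functions `z ↦ f (z, w)` of order at most `lam`,
the `p`-th derivative at `0` of the logarithmic derivative `z ↦ (∂f/∂z)(z,w) / f(z,w)`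
is holomorphic in `w`, and vanishes for all `p > lam` exactly at those `w` for which
`z ↦ f (z, w)` has no zeros. -/
theorem stmt_1
    (n : ℕ) (D : Set (Fin n → ℂ)) (hD : IsOpen D)
    (f : ℂ × (Fin n → ℂ) → ℂ)
    (hf : AnalyticOnNhd ℂ f (Set.univ ×ˢ D))
    (h0 : ∀ w ∈ D, f (0, w) ≠ 0)
    (lam : ℝ) (hlam : 0 ≤ lam)
    (hord : ∀ w ∈ D, ∃ C : ℝ, 0 < C ∧
      ∀ z : ℂ, ‖f (z, w)‖ ≤ C * Real.exp (C * ‖z‖ ^ lam))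
    (F : ℕ → (Fin n → ℂ) → ℂ)
    (hF : ∀ p : ℕ, ∀ w ∈ D,
      F p w = iteratedDeriv p (fun z : ℂ => deriv (fun z' : ℂ => f (z', w)) z / f (z, w)) 0) :
    (∀ p : ℕ, lam < p → AnalyticOnNhd ℂ (F p) D) ∧
      ∀ w ∈ D, ((∀ z : ℂ, f (z, w) ≠ 0) ↔ ∀ p : ℕ, lam < p → F p w = 0) := by
  have hU0 : IsOpen (Set.univ ×ˢ D : Set (ℂ × (Fin n → ℂ))) := isOpen_univ.prod hD
  have hslice : ∀ w ∈ D, Differentiable ℂ fun z => f (z, w) := fun w hw z =>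
    (hf (z, w) ⟨Set.mem_univ z, hw⟩).differentiableAt.comp z (by fun_prop)
  refine ⟨fun p _ w hw => ?_, fun w hw => ⟨fun hne p hp => ?_, fun hF0 => ?_⟩⟩
  · obtain ⟨f', hf', hff'⟩ := hf.exists_iteratedDeriv_fst hU0 1
    set U : Set (ℂ × (Fin n → ℂ)) := Set.univ ×ˢ D ∩ f ⁻¹' {0}ᶜ
    have hU : IsOpen U := hf.continuousOn.isOpen_inter_preimage hU0 isOpen_compl_singleton
    have hq : AnalyticOnNhd ℂ (fun x => f' x / f x) U := fun x hx =>
      (hf' x hx.1).div (hf x hx.1) hx.2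
    obtain ⟨H, hH, hqH⟩ := hq.exists_iteratedDeriv_fst hU p
    have hHw : AnalyticAt ℂ (fun w => H (0, w)) w :=
      (hH (0, w) ⟨⟨Set.mem_univ _, hw⟩, h0 w hw⟩).comp_of_eq
        (analyticAt_const.prod analyticAt_id) rfl
    refine hHw.congr ?_
    filter_upwards [hD.mem_nhds hw] with v hv
    rw [hF p v hv, ← hqH (0, v) ⟨⟨Set.mem_univ _, hv⟩, h0 v hv⟩]
    congr 1
    funext z
    rw [← hff' (z, v) ⟨Set.mem_univ _, hv⟩, iteratedDeriv_one]
  · obtain ⟨C, hC, hbd⟩ := hord w hw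
    rw [hF p w hw]
    exact Complex.iteratedDeriv_logDeriv_eq_zero (hslice w hw) hne hlam hC hbd hp
  · obtain ⟨N, hN⟩ := exists_nat_gt lam
    refine Complex.ne_zero_of_iteratedDeriv_logDeriv_eq_zero (hslice w hw) (h0 w hw) (N := N)
      fun p hp => ?_
    rw [← hF p w hw]
    exact hF0 p (hN.trans_le (by exact_mod_cast hp))
end

section
/- Let m : ℂ → ℕ be a multiplicity function with m(0) = 0, and let q be a positive natural number such that ∑_{a ∈ ℂ} m(a)·‖a‖^{-q} < ∞ (tsum over all a, which forces the support of m to be countable and bounded away from 0). If for every natural number p ≥ q one has ∑_{a ∈ ℂ} m(a)·a^{-p} = 0, then m(a) = 0 for every a ∈ ℂ. -/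
open Filter Topology in
/-- For a family of points of the circle there is an ultrafilter of large exponents along which
all the powers tend to `1` simultaneously. -/
lemma exists_ultrafilter_tendsto_circle_pow {ι : Type*} (u : ι → Circle) :
    ∃ F : Ultrafilter ℕ, (F : Filter ℕ) ≤ atTop ∧
      ∀ i, Tendsto (fun p : ℕ => u i ^ p) F (𝓝 1) := by
  obtain ⟨F, hF, hu⟩ := mapClusterPt_iff_ultrafilter.1 (mapClusterPt_one_atTop_pow u)
  exact ⟨F, hF, fun i => tendsto_pi_nhds.1 hu i⟩

/-- A nonzero multiplicity function with convergent `∑ m a * ‖a‖ ^ (-q)` has a point of smallest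
modulus in its support. -/
lemma exists_min_norm_of_summable (m : ℂ → ℕ) (hm0 : m 0 = 0) (q : ℕ)
    (hsum : Summable (fun a : ℂ => (m a : ℝ) * ‖a‖ ^ (-(q : ℤ)))) {b : ℂ} (hb : m b ≠ 0) :
    ∃ c : ℂ, m c ≠ 0 ∧ ∀ a, m a ≠ 0 → ‖c‖ ≤ ‖a‖ := by
  have ne_zero : ∀ a, m a ≠ 0 → a ≠ 0 := fun a ha h => ha (h ▸ hm0)
  have hbpos : 0 < ‖b‖ ^ (-(q : ℤ)) := zpow_pos (norm_pos_iff.2 (ne_zero b hb)) _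
  have hfin : {a : ℂ | m a ≠ 0 ∧ ‖a‖ ≤ ‖b‖}.Finite := by
    refine Set.Finite.subset (Filter.eventually_cofinite.1
      (hsum.tendsto_cofinite_zero.eventually_lt_const hbpos)) ?_
    rintro a ⟨ha, hab⟩
    have hapos : 0 < ‖a‖ := norm_pos_iff.2 (ne_zero a ha)
    have h1 : (1 : ℝ) ≤ m a := by exact_mod_cast Nat.one_le_iff_ne_zero.2 ha
    have h2 : ‖b‖ ^ (-(q : ℤ)) ≤ ‖a‖ ^ (-(q : ℤ)) := by
      simp only [zpow_neg, zpow_natCast]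
      gcongr
    exact not_lt.2 (h2.trans (le_mul_of_one_le_left (zpow_pos hapos _).le h1))
  obtain ⟨c, hc, hmin⟩ := Set.exists_min_image _ (fun a : ℂ => ‖a‖) hfin ⟨b, hb, le_rfl⟩
  refine ⟨c, hc.1, fun a ha => ?_⟩
  rcases le_total ‖a‖ ‖b‖ with h | h
  · exact hmin a ⟨ha, h⟩
  · exact hc.2.trans h

open Filter Topology in
/-- If `m : ℂ → ℕ` is a multiplicity function with `m 0 = 0` such that
`∑ m a * ‖a‖^(-q)` converges for some positive natural number `q`, and all the
"power sums" `∑ m a * a^(-p)` with `p ≥ q` vanish, then `m` vanishes identically. -/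
theorem stmt_3
    (m : ℂ → ℕ) (hm0 : m 0 = 0)
    (q : ℕ) (hq : 0 < q)
    (hsum : Summable (fun a : ℂ => (m a : ℝ) * ‖a‖ ^ (-(q : ℤ))))
    (hvanish : ∀ p : ℕ, q ≤ p → ∑' a : ℂ, (m a : ℂ) * a ^ (-(p : ℤ)) = 0) :
    ∀ a : ℂ, m a = 0 := by
  by_contra! ⟨b, hb⟩
  obtain ⟨c, hc, hmin⟩ := exists_min_norm_of_summable m hm0 q hsum hb
  have hr : 0 < ‖c‖ := norm_pos_iff.2 fun h => hc (h ▸ hm0)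
  set r := ‖c‖ with hrdef
  have hnorm : ∀ a : ℂ, ‖(r / a : ℂ)‖ = r / ‖a‖ := fun a => by simp [abs_of_pos hr]
  have hunit : ∀ a : ℂ, ‖a‖ = r → ‖(r / a : ℂ)‖ = 1 := fun a ha => by
    rw [hnorm, ha, div_self hr.ne']
  obtain ⟨F, hF, hlim⟩ := exists_ultrafilter_tendsto_circle_pow fun a : {a : ℂ // ‖a‖ = r} =>
    (⟨(r / a : ℂ), mem_sphere_zero_iff_norm.2 (hunit a a.2)⟩ : Circle)
  let h : ℂ → ℝ := fun a => if ‖a‖ = r then (m a : ℝ) else 0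
  let bound : ℂ → ℝ := fun a => m a * (r / ‖a‖) ^ q
  have hbound : Summable bound := by
    refine (hsum.mul_left (r ^ q)).congr fun a => ?_
    simp only [bound, zpow_neg, zpow_natCast, div_eq_mul_inv]
    ring
  have hpoint : ∀ a, Tendsto (fun p : ℕ => (m a : ℂ) * (r / a : ℂ) ^ p) F (𝓝 (h a : ℂ)) := by
    intro a
    by_cases ha : ‖a‖ = r
    · have hone : Tendsto (fun p : ℕ => (r / a : ℂ) ^ p) F (𝓝 1) :=
        (continuous_subtype_val.tendsto (1 : Circle)).comp (hlim ⟨a, ha⟩)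
      simpa [h, ha] using hone.const_mul (m a : ℂ)
    · by_cases hma : m a = 0
      · simp [h, hma]
      · have hlt : r < ‖a‖ := lt_of_le_of_ne (hmin a hma) (Ne.symm ha)
        have hlt1 : ‖(r / a : ℂ)‖ < 1 := by
          rw [hnorm]
          exact (div_lt_one (hr.trans hlt)).2 hlt
        simpa [h, ha] using
          ((tendsto_pow_atTop_nhds_zero_of_norm_lt_one hlt1).mono_left hF).const_mul (m a : ℂ)
  have hdom : ∀ᶠ p : ℕ in F, ∀ a, ‖(m a : ℂ) * (r / a : ℂ) ^ p‖ ≤ bound a := by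
    filter_upwards [hF (eventually_ge_atTop q)] with p hp a
    by_cases hma : m a = 0
    · simp [bound, hma]
    · have hle : r / ‖a‖ ≤ 1 := div_le_one_of_le₀ (hmin a hma) (norm_nonneg a)
      rw [norm_mul, norm_pow, hnorm, Complex.norm_natCast]
      exact mul_le_mul_of_nonneg_left
        (pow_le_pow_of_le_one (by positivity) hle hp) (Nat.cast_nonneg _)
  have hzero : ∀ᶠ p : ℕ in F, ∑' a : ℂ, (m a : ℂ) * (r / a : ℂ) ^ p = 0 := by
    filter_upwards [hF (eventually_ge_atTop q)] with p hp
    rw [← mul_zero ((r : ℂ) ^ p), ← hvanish p hp, ← tsum_mul_left]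
    refine tsum_congr fun a => ?_
    simp only [zpow_neg, zpow_natCast, div_eq_mul_inv]
    ring
  have hsum_zero : ∑' a, (h a : ℂ) = 0 :=
    tendsto_nhds_unique (tendsto_tsum_of_dominated_convergence hbound hpoint hdom)
      (tendsto_const_nhds.congr' (hzero.mono fun _ hp => hp.symm))
  have hreal : ∑' a, h a = 0 := by exact_mod_cast hsum_zero
  have hnonneg : ∀ a, 0 ≤ h a := fun a => by
    simp only [h]
    split_ifs <;> positivity
  have hle : ∀ a, h a ≤ bound a := fun a => by
    by_cases ha : ‖a‖ = r
    · simp [h, bound, ha, div_self hr.ne']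
    · simp only [h, bound, if_neg ha]
      positivity
  have hpos : 0 < h c := by
    simpa [h, hrdef] using Nat.pos_of_ne_zero hc
  exact ((hbound.of_nonneg_of_le hnonneg hle).tsum_pos hnonneg c hpos).ne' hreal
end

section
/- Let D ⊆ ℂⁿ be open and f : ℂ × D → ℂ a holomorphic function such that for every w ∈ D the entire function z ↦ f(z,w) is not identically zero. Then the set P = {w ∈ D : ∀ z ∈ ℂ, f(z,w) ≠ 0} is closed in D. -/
/-- For `f : ℂ × D → ℂ` holomorphic with `D ⊆ ℂⁿ` open and no function `z ↦ f (z, w)`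
identically zero, the set `P = {w ∈ D | ∀ z, f (z, w) ≠ 0}` is closed in `D`. -/
theorem stmt_5
    (n : ℕ) (D : Set (Fin n → ℂ)) (hD : IsOpen D)
    (f : ℂ × (Fin n → ℂ) → ℂ)
    (hf : AnalyticOnNhd ℂ f (Set.univ ×ˢ D))
    (hnz : ∀ w ∈ D, ∃ z : ℂ, f (z, w) ≠ 0) :
    closure {w ∈ D | ∀ z : ℂ, f (z, w) ≠ 0} ∩ D ⊆ {w ∈ D | ∀ z : ℂ, f (z, w) ≠ 0} := by
  rintro w₀ ⟨hcl, hw₀⟩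
  refine ⟨hw₀, fun z₀ h0 => ?_⟩
  have hslice : ∀ w ∈ D, AnalyticOnNhd ℂ (fun z => f (z, w)) Set.univ := fun w hw z _ =>
    (hf (z, w) ⟨Set.mem_univ z, hw⟩).fun_comp (f := fun z => (z, w)) (analyticAt_id.prod analyticAt_const)
  have hcont : ∀ z, ContinuousAt f (z, w₀) := fun z => (hf (z, w₀) ⟨Set.mem_univ z, hw₀⟩).continuousAt
  -- zeros of the slice at `w₀` are isolated
  have hiso : ∀ᶠ z in nhdsWithin z₀ {z₀}ᶜ, f (z, w₀) ≠ 0 := by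
    by_contra hfreq
    obtain ⟨z, hz⟩ := hnz w₀ hw₀
    exact hz ((hslice w₀ hw₀).eqOn_zero_of_preconnected_of_frequently_eq_zero
      isPreconnected_univ (Set.mem_univ z₀) hfreq (Set.mem_univ z))
  rw [eventually_nhdsWithin_iff, Metric.eventually_nhds_iff_ball] at hiso
  obtain ⟨ε, hε, hball⟩ := hiso
  have hr : 0 < ε / 2 := half_pos hε
  have hsphere : ∀ z ∈ Metric.sphere z₀ (ε / 2), f (z, w₀) ≠ 0 := fun z hz =>
    hball z (Metric.sphere_subset_closedBall.trans
      (Metric.closedBall_subset_ball (half_lt_self hε)) hz) (Metric.ne_of_mem_sphere hz hr.ne')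
  obtain ⟨z₁, hz₁, hmin⟩ := (isCompact_sphere z₀ (ε / 2)).exists_isMinOn
    (NormedSpace.sphere_nonempty.2 hr.le)
    (f := fun z => ‖f (z, w₀)‖) ((hslice w₀ hw₀).continuousOn.norm.mono (Set.subset_univ _))
  set δ := ‖f (z₁, w₀)‖ with hδ
  have hδ0 : 0 < δ := norm_pos_iff.2 (hsphere z₁ hz₁)
  have hbd : ∀ᶠ w in nhds w₀, ∀ z ∈ Metric.sphere z₀ (ε / 2), δ / 2 < ‖f (z, w)‖ := by
    refine (isCompact_sphere z₀ (ε / 2)).eventually_forall_of_forall_eventually fun z hz => ?_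
    have hlt : δ / 2 < ‖f (z, w₀)‖ := (half_lt_self hδ0).trans_le (hmin hz)
    have hswap : ContinuousAt (fun p : (Fin n → ℂ) × ℂ => ‖f (p.2, p.1)‖) (w₀, z) :=
      (ContinuousAt.comp' (f := fun p : (Fin n → ℂ) × ℂ => (p.2, p.1)) (hcont z)
        (by fun_prop)).norm
    exact hswap.eventually (lt_mem_nhds hlt)
  have hcenter : ∀ᶠ w in nhds w₀, ‖f (z₀, w)‖ < δ / 2 := by
    have h : ContinuousAt (fun w => ‖f (z₀, w)‖) w₀ :=
      (ContinuousAt.comp' (f := fun w => (z₀, w)) (hcont z₀) (by fun_prop)).norm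
    exact h.eventually (gt_mem_nhds (by simpa [h0] using hδ0))
  obtain ⟨w, ⟨hwD, hw⟩, hwb, hwc⟩ :=
    ((mem_closure_iff_frequently.1 hcl).and_eventually (hbd.and hcenter)).exists
  -- the maximum principle for the reciprocal of a zero-free slice near `w₀`
  have hdiff : Differentiable ℂ fun z => (f (z, w))⁻¹ := fun z =>
    ((hslice w hwD z (Set.mem_univ z)).differentiableAt).inv (hw z)
  have hmax := Complex.norm_le_of_forall_mem_frontier_norm_le (Metric.isBounded_ball (x := z₀)
    (r := ε / 2)) hdiff.diffContOnCl (C := (δ / 2)⁻¹) (fun z hz => by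
      rw [frontier_ball z₀ hr.ne'] at hz
      rw [norm_inv]
      exact inv_anti₀ (half_pos hδ0) (hwb z hz).le)
    (subset_closure (Metric.mem_ball_self hr))
  rw [norm_inv, inv_le_inv₀ (norm_pos_iff.2 (hw z₀)) (half_pos hδ0)] at hmax
  exact hmax.not_gt hwc
end

section
/- Let U ⊆ ℂⁿ be open and f : ℂ × U → ℂ a holomorphic function such that f(0,w) ≠ 0 for every w ∈ U and such that for every w ∈ U the entire function z ↦ f(z,w) is not identically zero. Define r : U → [0,∞] (with values in ℝ≥0∞) by r(w) = inf {‖z‖ : z ∈ ℂ, f(z,w) = 0}, where the infimum over the empty set is +∞. Then r is continuous on U (as a map into ℝ≥0∞ with its order topology), and r(w) > 0 for all w ∈ U. -/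
open scoped ENNReal

open Filter Topology Metric

/-- A function which is smaller at the center of a disc than everywhere on the boundary circle
has a zero in the disc. -/
theorem exists_zero_mem_closedBall_of_lt_norm_sphere {g : ℂ → ℂ} (hg : Differentiable ℂ g)
    {c : ℂ} {ρ m : ℝ} (hρ : 0 < ρ) (hc : ‖g c‖ < m) (hs : ∀ z ∈ sphere c ρ, m ≤ ‖g z‖) :
    ∃ z ∈ closedBall c ρ, g z = 0 := by
  by_contra! hne
  have hm : 0 < m := (norm_nonneg _).trans_lt hc
  have hd : DiffContOnCl ℂ (fun z => (g z)⁻¹) (ball c ρ) :=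
    hg.diffContOnCl.inv fun z hz => hne z (closure_ball_subset_closedBall hz)
  have hle : ‖(g c)⁻¹‖ ≤ m⁻¹ :=
    Complex.norm_le_of_forall_mem_frontier_norm_le isBounded_ball hd
      (fun z hz => by
        rw [frontier_ball c hρ.ne'] at hz
        rw [norm_inv]
        exact inv_anti₀ hm (hs z hz))
      (subset_closure (mem_ball_self hρ))
  rw [norm_inv] at hle
  have hpos : 0 < ‖g c‖ := norm_pos_iff.2 (hne c (mem_closedBall_self hρ.le))
  exact absurd ((inv_le_inv₀ hpos hm).1 hle) hc.not_ge

/-- Nonvanishing on a compact set is stable under small changes of the parameter. -/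
theorem eventually_forall_mem_ne_zero {X Y : Type*} [TopologicalSpace X] [TopologicalSpace Y]
    {f : X × Y → ℂ} {K : Set X} (hK : IsCompact K) {y : Y}
    (hf : ∀ x ∈ K, ContinuousAt f (x, y)) (hne : ∀ x ∈ K, f (x, y) ≠ 0) :
    ∀ᶠ y' in 𝓝 y, ∀ x ∈ K, f (x, y') ≠ 0 :=
  hK.eventually_forall_of_forall_eventually fun x hx =>
    (continuous_swap.tendsto (y, x)).eventually ((hf x hx).eventually_ne (hne x hx))

/-- Zeros of a holomorphic family of entire functions persist, locally, under small changes of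
the parameter. -/
theorem eventually_exists_zero_mem_closedBall {E : Type*} [NormedAddCommGroup E]
    [NormedSpace ℂ E] {U : Set E} (hU : IsOpen U) {f : ℂ × E → ℂ}
    (hf : AnalyticOnNhd ℂ f (Set.univ ×ˢ U)) {w : E} (hw : w ∈ U) (hnz : ∃ z, f (z, w) ≠ 0)
    {c : ℂ} (hc : f (c, w) = 0) {ε : ℝ} (hε : 0 < ε) :
    ∀ᶠ w' in 𝓝 w, ∃ z ∈ closedBall c ε, f (z, w') = 0 := by
  have hsec : ∀ v ∈ U, AnalyticOnNhd ℂ (fun z => f (z, v)) Set.univ := fun v hv z _ =>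
    (hf (z, v) ⟨trivial, hv⟩).comp₂ analyticAt_id analyticAt_const
  have hcont : ∀ z, ContinuousAt f (z, w) := fun z => (hf (z, w) ⟨trivial, hw⟩).continuousAt
  have hiso : ∀ᶠ z in 𝓝[≠] c, f (z, w) ≠ 0 := by
    refine (hsec w hw c trivial).eventually_eq_zero_or_eventually_ne_zero.resolve_left fun h => ?_
    obtain ⟨z, hz⟩ := hnz
    exact hz ((hsec w hw).eqOn_zero_of_preconnected_of_eventuallyEq_zero isPreconnected_univ
      trivial h trivial)
  obtain ⟨δ, hδ, hball⟩ := Metric.eventually_nhds_iff.1 (eventually_nhdsWithin_iff.1 hiso)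
  obtain ⟨ρ, hρ, hρlt⟩ := exists_between (lt_min hε hδ)
  have hne : ∀ z ∈ sphere c ρ, f (z, w) ≠ 0 := fun z hz =>
    hball ((mem_sphere.1 hz).trans_lt (hρlt.trans_le (min_le_right _ _)))
      (ne_of_mem_sphere hz hρ.ne')
  obtain ⟨z₀, hz₀, hmin⟩ := (isCompact_sphere c ρ).exists_isMinOn
    (NormedSpace.sphere_nonempty.2 hρ.le) (f := fun z => ‖f (z, w)‖)
    ((hsec w hw).continuousOn.norm.mono (Set.subset_univ _))
  obtain ⟨m, hm, hmlt⟩ := exists_between (norm_pos_iff.2 (hne z₀ hz₀))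
  have hsphere : ∀ᶠ w' in 𝓝 w, ∀ z ∈ sphere c ρ, m < ‖f (z, w')‖ :=
    (isCompact_sphere c ρ).eventually_forall_of_forall_eventually fun z hz =>
      (continuous_swap.tendsto (w, z)).eventually
        ((hcont z).norm.eventually (lt_mem_nhds (hmlt.trans_le (hmin hz))))
  have hcenter : ∀ᶠ w' in 𝓝 w, ‖f (c, w')‖ < m := by
    have h : ContinuousAt (fun w' => ‖f (c, w')‖) w :=
      ((hcont c).comp (f := fun w' => (c, w')) (by fun_prop)).norm
    exact h.eventually (gt_mem_nhds (by simpa [hc] using hm))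
  filter_upwards [hsphere, hcenter, hU.mem_nhds hw] with w' hs hlt hw'
  obtain ⟨z, hz, hz0⟩ := exists_zero_mem_closedBall_of_lt_norm_sphere
    (fun z => (hsec w' hw' z trivial).differentiableAt) hρ hlt fun z hz => (hs z hz).le
  exact ⟨z, closedBall_subset_closedBall (hρlt.le.trans (min_le_left _ _)) hz, hz0⟩

/-- For `f : ℂ × U → ℂ` holomorphic with `U ⊆ ℂⁿ` open, `f (0, w) ≠ 0` on `U`, and no
function `z ↦ f (z, w)` identically zero, the smallest modulus `r w` of a zero of
`z ↦ f (z, w)` (equal to `+∞` if there is no zero), as a function `U → ℝ≥0∞`, is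
continuous on `U` and strictly positive. -/
theorem stmt_6
    (n : ℕ) (U : Set (Fin n → ℂ)) (hU : IsOpen U)
    (f : ℂ × (Fin n → ℂ) → ℂ)
    (hf : AnalyticOnNhd ℂ f (Set.univ ×ˢ U))
    (h0 : ∀ w ∈ U, f (0, w) ≠ 0)
    (hnz : ∀ w ∈ U, ∃ z : ℂ, f (z, w) ≠ 0)
    (r : (Fin n → ℂ) → ℝ≥0∞)
    (hr : ∀ w, r w = sInf {x : ℝ≥0∞ | ∃ z : ℂ, f (z, w) = 0 ∧ x = (‖z‖₊ : ℝ≥0∞)}) :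
    ContinuousOn r U ∧ ∀ w ∈ U, 0 < r w := by
  have hr_le : ∀ w z, f (z, w) = 0 → r w ≤ (‖z‖₊ : ℝ≥0∞) := fun w z hz => by
    rw [hr]
    exact sInf_le ⟨z, hz, rfl⟩
  have hle_r : ∀ w (b : NNReal), (∀ z ∈ ball (0 : ℂ) b, f (z, w) ≠ 0) → (b : ℝ≥0∞) ≤ r w := by
    intro w b hb
    rw [hr]
    refine le_sInf ?_
    rintro _ ⟨z, hz, rfl⟩
    by_contra! h
    exact hb z (mem_ball_zero_iff.2 (ENNReal.coe_lt_coe.1 h)) hz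
  have hcont : ∀ w ∈ U, ∀ z, ContinuousAt f (z, w) := fun w hw z =>
    (hf (z, w) ⟨trivial, hw⟩).continuousAt
  refine ⟨fun w hw => ContinuousAt.continuousWithinAt (tendsto_order.2 ⟨fun a ha => ?_,
    fun a ha => ?_⟩), fun w hw => ?_⟩
  · obtain ⟨b, hab, hbr⟩ := ENNReal.lt_iff_exists_nnreal_btwn.1 ha
    have hne : ∀ z ∈ closedBall (0 : ℂ) b, f (z, w) ≠ 0 := fun z hz hz0 =>
      (hbr.trans_le (hr_le w z hz0)).not_ge
        (ENNReal.coe_le_coe.2 (mem_closedBall_zero_iff.1 hz))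
    filter_upwards [eventually_forall_mem_ne_zero (isCompact_closedBall 0 (b : ℝ))
      (fun z _ => hcont w hw z) hne] with w' hw'
    exact hab.trans_le (hle_r w' b fun z hz => hw' z (ball_subset_closedBall hz))
  · rw [hr] at ha
    obtain ⟨_, ⟨c, hc, rfl⟩, hca⟩ := sInf_lt_iff.1 ha
    obtain ⟨b, hcb, hba⟩ := ENNReal.lt_iff_exists_nnreal_btwn.1 hca
    have hcb' : ‖c‖ < b := ENNReal.coe_lt_coe.1 hcb
    filter_upwards [eventually_exists_zero_mem_closedBall hU hf hw (hnz w hw) hc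
      (sub_pos.2 hcb')] with w' ⟨z, hz, hz0⟩
    have hzb : ‖z‖ ≤ b := by
      have := norm_le_norm_add_norm_sub' z c
      rw [mem_closedBall, dist_eq_norm] at hz
      linarith
    exact ((hr_le w' z hz0).trans (ENNReal.coe_le_coe.2 hzb)).trans_lt hba
  · have hev : ∀ᶠ z in 𝓝 (0 : ℂ), f (z, w) ≠ 0 :=
      ((hcont w hw 0).comp (f := fun z => (z, w)) (by fun_prop)).eventually_ne (h0 w hw)
    obtain ⟨δ, hδ, hball⟩ := Metric.eventually_nhds_iff_ball.1 hev
    lift δ to NNReal using hδ.le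
    exact (ENNReal.coe_pos.2 (by exact_mod_cast hδ)).trans_le (hle_r w δ hball)
end

section
/- Let U ⊆ ℂ be open and f : ℂ × U → ℂ a holomorphic function such that f(0,w) ≠ 0 for every w ∈ U and such that for every w ∈ U the entire function z ↦ f(z,w) is not identically zero. Define r(w) = inf {‖z‖ : f(z,w) = 0} ∈ (0,∞], the smallest modulus of a zero of z ↦ f(z,w) (+∞ if there are none). Let w₀ ∈ U with r(w₀) < ∞. Then there exists δ₀ > 0 such that for every δ with 0 < δ < δ₀ the closed disc {w : |w−w₀| ≤ δ} is contained in U, r(w₀ + δe^{iθ}) < ∞ for all θ, and the sub-mean-value inequality (1/(2π)) ∫_{−π}^{π} log r(w₀ + δe^{iθ}) dθ ≤ log r(w₀) holds. -/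
open scoped ENNReal Real
open Complex Metric Set Filter Topology MeasureTheory

/-- An analytic function without zeros on the boundary circle of a closed disc is a finite product
of linear factors times a zero-free analytic function, near each point of the disc. -/
lemma AnalyticOnNhd.exists_eventuallyEq_prod_zpow_mul {g : ℂ → ℂ} {c : ℂ} {ε : ℝ} (hε : 0 < ε)
    (hg : AnalyticOnNhd ℂ g (closedBall c ε)) (hne : ∀ z ∈ sphere c ε, g z ≠ 0) :
    ∃ (s : Finset ℂ) (n : ℂ → ℤ) (h : ℂ → ℂ),
      (∀ u ∈ s, u ∈ ball c ε ∧ g u = 0 ∧ 0 < n u) ∧ (∀ u ∈ ball c ε, g u = 0 → u ∈ s) ∧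
      AnalyticOnNhd ℂ h (closedBall c ε) ∧ (∀ z ∈ closedBall c ε, h z ≠ 0) ∧
      ∀ z ∈ closedBall c ε, g =ᶠ[𝓝 z] fun x ↦ (∏ u ∈ s, (x - u) ^ n u) * h x := by
  set K := closedBall c ε
  have hpre : IsPreconnected K := (convex_closedBall c ε).isPreconnected
  obtain ⟨p, hp⟩ : (sphere c ε).Nonempty := NormedSpace.sphere_nonempty.2 hε.le
  have hpK : p ∈ K := sphere_subset_closedBall hp
  have hnt : K.Nontrivial :=
    ⟨c, mem_closedBall_self hε.le, p, hpK, fun h ↦ by simp [← h, hε.ne] at hp⟩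
  have htop (u) (hu : u ∈ K) : meromorphicOrderAt g u ≠ ⊤ := by
    refine hg.meromorphicOn.meromorphicOrderAt_ne_top_of_isPreconnected hpre hpK hu ?_
    rw [(hg p hpK).meromorphicOrderAt_eq, (hg p hpK).analyticOrderAt_eq_zero.2 (hne p hp)]
    simp
  have hfin := (MeromorphicOn.divisor g K).finiteSupport (isCompact_closedBall c ε)
  have hzero (u) (hu : u ∈ K) : MeromorphicOn.divisor g K u = 0 ↔ g u ≠ 0 := by
    have := htop u hu
    rw [MeromorphicOn.divisor_apply hg.meromorphicOn hu, ← (hg u hu).analyticOrderAt_eq_zero]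
    rw [(hg u hu).meromorphicOrderAt_eq] at this ⊢
    generalize analyticOrderAt g u = a at *
    induction a using ENat.recTopCoe <;> simp_all
  obtain ⟨h, hh, hh0, heq⟩ :=
    hg.meromorphicOn.extract_zeros_poles (fun u ↦ htop u u.2) hfin
  set D := MeromorphicOn.divisor g K
  have hnn : 0 ≤ D := MeromorphicOn.AnalyticOnNhd.divisor_nonneg hg
  have hprod : (∏ᶠ u, (· - u) ^ D u) • h =
      fun x ↦ (∏ u ∈ hfin.toFinset, (x - u) ^ D u) * h x := by
    rw [Function.FactorizedRational.finprod_eq_fun hfin]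
    ext x
    simp only [Pi.smul_apply', smul_eq_mul]
    rw [finprod_eq_prod_of_mulSupport_subset]
    intro u hu
    simp only [Function.mem_mulSupport] at hu
    simp only [Finite.coe_toFinset, Function.mem_support]
    intro h0
    simp [h0] at hu
  rw [hprod] at heq
  refine ⟨hfin.toFinset, D, h, ?_, ?_, hh, fun z hz ↦ hh0 ⟨z, hz⟩, ?_⟩
  · intro u hu
    simp only [Finite.mem_toFinset, Function.mem_support] at hu
    have huK : u ∈ K := D.supportWithinDomain hu
    have hgu : g u = 0 := by simpa [hzero u huK] using hu
    refine ⟨?_, hgu, lt_of_le_of_ne (hnn u) (Ne.symm hu)⟩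
    by_contra hb
    refine hne u ?_ hgu
    simp only [K, mem_closedBall, mem_ball, mem_sphere] at *
    linarith
  · intro u hu hgu
    simp [hzero u (ball_subset_closedBall hu), hgu]
  · intro z hz
    have han : AnalyticAt ℂ (fun x ↦ (∏ u ∈ hfin.toFinset, (x - u) ^ D u) * h x) z := by
      refine AnalyticAt.mul (Finset.analyticAt_fun_prod _ fun u _ ↦ ?_) (hh z hz)
      exact AnalyticAt.zpow_nonneg (by fun_prop) (hnn u)
    refine ((hg z hz).frequently_eq_iff_eventually_eq han).1 ?_
    have h1 := accPt_iff_frequently_nhdsNE.1 (hpre.preperfect_of_nontrivial hnt z hz)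
    have h2 := mem_codiscreteWithin.1 heq z hz
    rw [disjoint_principal_right] at h2
    refine (h1.and_eventually h2).mono fun x hx ↦ ?_
    by_contra hc
    exact hx.2 ⟨hx.1, hc⟩

/-- The generalized argument principle on a disc. -/
lemma AnalyticOnNhd.exists_circleIntegral_mul_logDeriv {g : ℂ → ℂ} {c : ℂ} {ε : ℝ} (hε : 0 < ε)
    (hg : AnalyticOnNhd ℂ g (closedBall c ε)) (hne : ∀ z ∈ sphere c ε, g z ≠ 0) :
    ∃ (s : Finset ℂ) (n : ℂ → ℤ),
      (∀ u ∈ s, u ∈ ball c ε ∧ g u = 0 ∧ 0 < n u) ∧ (∀ u ∈ ball c ε, g u = 0 → u ∈ s) ∧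
      ∀ φ : ℂ → ℂ, AnalyticOnNhd ℂ φ (closedBall c ε) →
        ∮ z in C(c, ε), φ z * logDeriv g z = 2 * π * I * ∑ u ∈ s, n u * φ u := by
  obtain ⟨s, n, h, hs, hs', hh, hh0, heq⟩ := hg.exists_eventuallyEq_prod_zpow_mul hε hne
  refine ⟨s, n, hs, hs', fun φ hφ ↦ ?_⟩
  have hsub : sphere c ε ⊆ closedBall c ε := sphere_subset_closedBall
  have hcl : closure (ball c ε) = closedBall c ε := closure_ball c hε.ne'
  have hnz (z) (hz : z ∈ sphere c ε) (u) (hu : u ∈ s) : z - u ≠ 0 := by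
    rintro h0
    rw [sub_eq_zero] at h0
    have := (hs u hu).1
    rw [← h0, mem_ball, mem_sphere.1 hz] at this
    exact this.false
  have hφd : DiffContOnCl ℂ φ (ball c ε) :=
    DifferentiableOn.diffContOnCl (hcl ▸ hφ.differentiableOn)
  have hlog : AnalyticOnNhd ℂ (fun z ↦ φ z * logDeriv h z) (closedBall c ε) := fun z hz ↦
    (hφ z hz).mul ((hh z hz).deriv.div (hh z hz) (hh0 z hz))
  have hint (z) (hz : z ∈ sphere c ε) : φ z * logDeriv g z =
      (∑ u ∈ s, (n u : ℂ) • ((z - u)⁻¹ • φ z)) + φ z * logDeriv h z := by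
    have hzz := hsub hz
    have e : logDeriv g z = logDeriv (fun x ↦ (∏ u ∈ s, (x - u) ^ n u) * h x) z := by
      simp only [logDeriv_apply, (heq z hzz).deriv_eq, (heq z hzz).eq_of_nhds]
    rw [e, logDeriv_mul, logDeriv_prod, mul_add, Finset.mul_sum]
    · congr 1
      refine Finset.sum_congr rfl fun u hu ↦ ?_
      rw [logDeriv_fun_zpow (by fun_prop)]
      simp [logDeriv_apply]
      ring
    · exact fun u hu ↦ zpow_ne_zero _ (hnz z hz u hu)
    · exact fun u hu ↦ DifferentiableAt.zpow (by fun_prop) (.inl (hnz z hz u hu))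
    · exact Finset.prod_ne_zero_iff.2 fun u hu ↦ zpow_ne_zero _ (hnz z hz u hu)
    · exact hh0 z hzz
    · exact DifferentiableAt.fun_finsetProd fun u hu ↦
        DifferentiableAt.zpow (by fun_prop) (.inl (hnz z hz u hu))
    · exact (hh z hzz).differentiableAt
  have hci (u) (hu : u ∈ s) : CircleIntegrable (fun z ↦ (n u : ℂ) • ((z - u)⁻¹ • φ z)) c ε := by
    refine ContinuousOn.circleIntegrable hε.le (.fun_const_smul (.fun_smul (f := fun z ↦ (z - u)⁻¹)
      (.inv₀ (by fun_prop) fun z hz ↦ hnz z hz u hu) (hφ.continuousOn.mono hsub)) _)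
  rw [circleIntegral.integral_congr hε.le hint, circleIntegral.integral_add,
    circleIntegral.integral_fun_sum hci, DiffContOnCl.circleIntegral_eq_zero hε.le
      (DifferentiableOn.diffContOnCl (hcl ▸ hlog.differentiableOn)), add_zero, Finset.mul_sum]
  · refine Finset.sum_congr rfl fun u hu ↦ ?_
    rw [circleIntegral.integral_smul, hφd.circleIntegral_sub_inv_smul (hs u hu).1]
    simp only [smul_eq_mul]
    ring
  · refine ContinuousOn.circleIntegrable hε.le (continuousOn_finsetSum _ fun u hu ↦ ?_)
    exact .fun_const_smul (.fun_smul (f := fun z ↦ (z - u)⁻¹)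
      (.inv₀ (by fun_prop) fun z hz ↦ hnz z hz u hu) (hφ.continuousOn.mono hsub)) _
  · exact (hlog.continuousOn.mono hsub).circleIntegrable hε.le

lemma continuous_uncurry_comp_circleMap {H : ℂ × ℂ → ℂ} {c w₀ : ℂ} {ε δ : ℝ} (hε : 0 ≤ ε)
    (hδ : 0 ≤ δ) (hH : ContinuousOn H (sphere c ε ×ˢ sphere w₀ δ)) :
    Continuous (Function.uncurry fun t θ : ℝ ↦
      deriv (circleMap c ε) θ • H (circleMap c ε θ, circleMap w₀ δ t)) := by
  simp only [deriv_circleMap, Function.uncurry_def]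
  refine .smul (f := fun p : ℝ × ℝ ↦ circleMap 0 ε p.2 * I) (by fun_prop)
    (hH.comp_continuous (f := fun p : ℝ × ℝ ↦ (circleMap c ε p.2, circleMap w₀ δ p.1))
      (by fun_prop) fun x ↦ ⟨?_, ?_⟩)
  · exact circleMap_mem_sphere _ hε _
  · exact circleMap_mem_sphere _ hδ _

lemma continuous_circleIntegral_circleMap {H : ℂ × ℂ → ℂ} {c w₀ : ℂ} {ε δ : ℝ} (hε : 0 ≤ ε)
    (hδ : 0 ≤ δ) (hH : ContinuousOn H (sphere c ε ×ˢ sphere w₀ δ)) :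
    Continuous fun t : ℝ ↦ ∮ z in C(c, ε), H (z, circleMap w₀ δ t) :=
  intervalIntegral.continuous_parametric_intervalIntegral_of_continuous
    (continuous_uncurry_comp_circleMap hε hδ hH) continuous_const

/-- Mean value property of a circle integral depending analytically on a parameter. -/
lemma AnalyticOnNhd.circleAverage_circleIntegral {H : ℂ × ℂ → ℂ} {c w₀ : ℂ} {ε δ : ℝ}
    (hε : 0 ≤ ε) (hδ : 0 < δ) (hH : AnalyticOnNhd ℂ H (sphere c ε ×ˢ closedBall w₀ δ)) :
    Real.circleAverage (fun w ↦ ∮ z in C(c, ε), H (z, w)) w₀ δ = ∮ z in C(c, ε), H (z, w₀) := by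
  have hcont := continuous_uncurry_comp_circleMap hε hδ.le
    (hH.continuousOn.mono (prod_mono_right sphere_subset_closedBall))
  rw [Real.circleAverage_def]
  simp only [circleIntegral]
  rw [intervalIntegral_intervalIntegral_swap, ← intervalIntegral.integral_smul]
  · refine intervalIntegral.integral_congr fun θ _ ↦ ?_
    have hz : circleMap c ε θ ∈ sphere c ε := circleMap_mem_sphere _ hε _
    have hd : DiffContOnCl ℂ (fun w ↦ H (circleMap c ε θ, w)) (ball w₀ |δ|) := by
      refine DifferentiableOn.diffContOnCl ?_
      rw [abs_of_pos hδ, closure_ball _ hδ.ne']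
      intro w hw
      exact ((hH (circleMap c ε θ, w) ⟨hz, hw⟩).differentiableAt.comp w
        (by fun_prop : DifferentiableAt ℂ (fun w ↦ (circleMap c ε θ, w)) w)).differentiableWithinAt
    have := hd.circleAverage
    rw [Real.circleAverage_def] at this
    simp only [intervalIntegral.integral_smul, ← this]
    rw [smul_comm]
  · exact (hcont.continuousOn.integrableOn_compact (isCompact_uIcc.prod isCompact_uIcc)).mono_set
      (prod_mono uIoc_subset_uIcc uIoc_subset_uIcc)

lemma Continuous.eq_of_forall_exists_int {g : ℝ → ℂ} (hg : Continuous g)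
    (h : ∀ t, ∃ n : ℤ, g t = n) (t t' : ℝ) : g t = g t' := by
  choose n hn using h
  have : Continuous n := by
    rw [Complex.isClosedEmbedding_intCast.isInducing.continuous_iff]
    exact hg.congr hn
  rw [hn, hn, PreconnectedSpace.constant inferInstance this]

lemma LowerSemicontinuousAt.sInf_nnnorm_zeros {U : Set ℂ} (hU : IsOpen U) {f : ℂ × ℂ → ℂ}
    (hf : ContinuousOn f (univ ×ˢ U)) {r : ℂ → ℝ≥0∞}
    (hr : ∀ w, r w = sInf {x : ℝ≥0∞ | ∃ z : ℂ, f (z, w) = 0 ∧ x = (‖z‖₊ : ℝ≥0∞)})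
    {w : ℂ} (hw : w ∈ U) : LowerSemicontinuousAt r w := by
  intro t ht
  obtain ⟨t', htt', ht'⟩ := ENNReal.lt_iff_exists_nnreal_btwn.1 ht
  have key : ∀ᶠ w' in 𝓝 w, ∀ z ∈ closedBall (0 : ℂ) t', f (z, w') ≠ 0 := by
    refine (isCompact_closedBall _ _).eventually_forall_of_forall_eventually fun z hz ↦ ?_
    have h0 : f (z, w) ≠ 0 := by
      intro h0
      have : r w ≤ ‖z‖₊ := hr w ▸ sInf_le ⟨z, h0, rfl⟩
      have hz' : ‖z‖₊ ≤ t' := mem_closedBall_zero_iff.1 hz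
      exact absurd (ht'.trans_le this) (not_lt.2 (by exact_mod_cast hz'))
    have hc : ContinuousAt f (z, w) :=
      hf.continuousAt ((isOpen_univ.prod hU).mem_nhds ⟨mem_univ _, hw⟩)
    have hc' : ContinuousAt (fun p : ℂ × ℂ ↦ f (p.2, p.1)) (w, z) :=
      ContinuousAt.comp (f := fun p : ℂ × ℂ ↦ (p.2, p.1)) hc (by fun_prop)
    exact hc'.eventually_ne h0
  filter_upwards [key] with w' hw'
  refine htt'.trans_le ?_
  rw [hr]
  refine le_sInf ?_
  rintro _ ⟨z, hz, rfl⟩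
  by_contra hlt
  rw [not_le] at hlt
  refine hw' z ?_ hz
  have : ‖z‖₊ < t' := by exact_mod_cast hlt
  exact mem_closedBall_zero_iff.2 this.le

lemma exists_zero_nnnorm_eq_sInf {g : ℂ → ℂ} (hg : Continuous g)
    (hfin : sInf {x : ℝ≥0∞ | ∃ z : ℂ, g z = 0 ∧ x = (‖z‖₊ : ℝ≥0∞)} < ⊤) :
    ∃ z, g z = 0 ∧ sInf {x : ℝ≥0∞ | ∃ z : ℂ, g z = 0 ∧ x = (‖z‖₊ : ℝ≥0∞)} = ‖z‖₊ := by
  obtain ⟨-, ⟨z₁, hz₁, -⟩, -⟩ := sInf_lt_iff.1 hfin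
  obtain ⟨z, hz, hd⟩ := (isClosed_eq hg continuous_const).exists_infDist_eq_dist ⟨z₁, hz₁⟩ 0
  refine ⟨z, hz, le_antisymm (sInf_le ⟨z, hz, rfl⟩) (le_sInf ?_)⟩
  rintro _ ⟨y, hy, rfl⟩
  have := infDist_le_dist_of_mem (x := 0) (s := {y | g y = 0}) hy
  rw [hd, dist_zero_left, dist_zero_left] at this
  exact_mod_cast this

/-- The key estimate on a single circle, given a disc around a minimal zero `z₀` of `f (·, w₀)`
which contains no other zero of `f (·, w₀)`. -/
lemma circleAverage_log_smallest_zero_le {U : Set ℂ} {f : ℂ × ℂ → ℂ}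
    (hf : AnalyticOnNhd ℂ f (univ ×ˢ U)) {r : ℂ → ℝ≥0∞}
    (hle : ∀ w z, f (z, w) = 0 → r w ≤ ‖z‖₊) {w₀ z₀ : ℂ} {ε δ ρ : ℝ} (hε : 0 < ε) (hδ : 0 < δ)
    (hεz : ε < ‖z₀‖) (hz₀ : f (z₀, w₀) = 0)
    (hiso : ∀ z ∈ ball z₀ ε, f (z, w₀) = 0 → z = z₀)
    (hU : closedBall w₀ δ ⊆ U)
    (hne : ∀ w ∈ closedBall w₀ δ, ∀ z ∈ sphere z₀ ε, f (z, w) ≠ 0)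
    (hρ : 0 < ρ) (hρr : ∀ w ∈ closedBall w₀ δ, ENNReal.ofReal ρ < r w)
    (hlsc : ∀ w ∈ closedBall w₀ δ, LowerSemicontinuousAt r w) :
    (∀ w ∈ sphere w₀ δ, r w < ⊤) ∧
      Real.circleAverage (fun w ↦ Real.log (r w).toReal) w₀ δ ≤ Real.log ‖z₀‖ := by
  have hz₀0 : z₀ ≠ 0 := norm_pos_iff.1 (hε.trans hεz)
  set F : ℂ × ℂ → ℂ := fun p ↦ fderiv ℂ f p (1, 0) / f p
  have hFan : AnalyticOnNhd ℂ F (sphere z₀ ε ×ˢ closedBall w₀ δ) := by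
    rintro ⟨z, w⟩ ⟨hz, hw⟩
    have := hf (z, w) ⟨mem_univ _, hU hw⟩
    exact ((ContinuousLinearMap.apply ℂ ℂ ((1, 0) : ℂ × ℂ)).analyticAt _ |>.comp
      this.fderiv).div this (hne w hw z hz)
  have hFlog (w) (hw : w ∈ U) (z : ℂ) : logDeriv (fun z ↦ f (z, w)) z = F (z, w) := by
    have h1 := (hf (z, w) ⟨mem_univ _, hw⟩).differentiableAt.hasFDerivAt
    have h2 : HasDerivAt (fun z : ℂ ↦ (z, w)) ((1, 0) : ℂ × ℂ) z :=
      (hasDerivAt_id z).prodMk (hasDerivAt_const z w)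
    have h3 : HasDerivAt (fun z ↦ f (z, w)) (fderiv ℂ f (z, w) (1, 0)) z := h1.comp_hasDerivAt z h2
    rw [logDeriv_apply, h3.deriv]
  set φ : ℂ → ℂ := fun z ↦ Complex.log (z / z₀) with hφ
  have hball (z) (hz : z ∈ closedBall z₀ ε) : z / z₀ ∈ slitPlane := by
    refine mem_slitPlane_of_norm_lt_one (z := z / z₀ - 1) ?_ |> fun h ↦ by simpa using h
    rw [div_sub_one hz₀0, norm_div, div_lt_one (norm_pos_iff.2 hz₀0), ← dist_eq_norm]
    exact (mem_closedBall.1 hz).trans_lt hεz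
  have hφan : AnalyticOnNhd ℂ φ (closedBall z₀ ε) := fun z hz ↦
    AnalyticAt.clog (by fun_prop) (hball z hz)
  have hφre (z) (hz : z ∈ ball z₀ ε) : (φ z).re = Real.log ‖z‖ - Real.log ‖z₀‖ := by
    have hz0 : z ≠ 0 := fun h ↦ by
      simpa [h] using slitPlane_ne_zero (hball z (ball_subset_closedBall hz))
    rw [hφ, Complex.log_re, norm_div, Real.log_div (norm_ne_zero_iff.2 hz0)
      (norm_ne_zero_iff.2 hz₀0)]
  have harg (w) (hw : w ∈ closedBall w₀ δ) : ∃ (s : Finset ℂ) (n : ℂ → ℤ),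
      (∀ u ∈ s, u ∈ ball z₀ ε ∧ f (u, w) = 0 ∧ 0 < n u) ∧
      (∀ u ∈ ball z₀ ε, f (u, w) = 0 → u ∈ s) ∧
      ∀ φ : ℂ → ℂ, AnalyticOnNhd ℂ φ (closedBall z₀ ε) →
        ∮ z in C(z₀, ε), φ z * F (z, w) = 2 * π * I * ∑ u ∈ s, n u * φ u := by
    have := AnalyticOnNhd.exists_circleIntegral_mul_logDeriv (g := fun z ↦ f (z, w)) hε
      (fun z _ ↦ (hf (z, w) ⟨mem_univ _, hU hw⟩).curry_left) (hne w hw)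
    simpa only [hFlog w (hU hw)] using this
  choose! s n hs hs' hint using harg
  have hw₀ : w₀ ∈ closedBall w₀ δ := mem_closedBall_self hδ.le
  have hpi : (2 * π * I : ℂ) ≠ 0 := two_pi_I_ne_zero
  have hcirc (t : ℝ) : circleMap w₀ δ t ∈ closedBall w₀ δ :=
    circleMap_mem_closedBall _ hδ.le _
  have hFc : ContinuousOn F (sphere z₀ ε ×ˢ sphere w₀ δ) :=
    hFan.continuousOn.mono (prod_mono_right sphere_subset_closedBall)
  -- the number of zeros in the disc does not depend on `w`
  have hcount (w) (hw : w ∈ closedBall w₀ δ) :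
      ∮ z in C(z₀, ε), F (z, w) = 2 * π * I * (∑ u ∈ s w, n w u : ℤ) := by
    simpa using hint w hw (fun _ ↦ 1) analyticOnNhd_const
  set m : ℤ := ∑ u ∈ s w₀, n w₀ u with hm
  have hm0 : 0 < m :=
    Finset.sum_pos (fun u hu ↦ (hs w₀ hw₀ u hu).2.2)
      ⟨z₀, hs' w₀ hw₀ z₀ (mem_ball_self hε) hz₀⟩
  have hconst (w) (hw : w ∈ sphere w₀ δ) : ∑ u ∈ s w, n w u = m := by
    obtain ⟨t, rfl⟩ : ∃ t, circleMap w₀ δ t = w := by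
      have := range_circleMap w₀ δ
      rw [abs_of_pos hδ] at this
      rwa [← this] at hw
    have hc := (continuous_circleIntegral_circleMap hε.le hδ.le hFc).const_mul (2 * π * I : ℂ)⁻¹
    have hc' := hc.eq_of_forall_exists_int fun t' ↦
      ⟨_, by rw [hcount _ (hcirc t'), inv_mul_cancel_left₀ hpi]⟩
    have havg := hFan.circleAverage_circleIntegral hε.le hδ
    rw [Real.circleAverage_congr_sphere (f₂ := fun _ ↦ ∮ z in C(z₀, ε), F (z, circleMap w₀ δ t)),
      Real.circleAverage_const, hcount _ hw₀, hcount _ (hcirc t)] at havg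
    · exact_mod_cast mul_left_cancel₀ hpi havg
    · intro w' hw'
      rw [← range_circleMap] at hw'
      obtain ⟨t', rfl⟩ := hw'
      exact mul_left_cancel₀ (inv_ne_zero hpi) (hc' t' t)
  have hnonempty (w) (hw : w ∈ sphere w₀ δ) : (s w).Nonempty := by
    by_contra! hempty
    have := hconst w hw
    rw [hempty, Finset.sum_empty] at this
    exact hm0.ne this
  have hfin (w) (hw : w ∈ sphere w₀ δ) : r w ≤ ENNReal.ofReal (‖z₀‖ + ε) := by
    have hw' := sphere_subset_closedBall hw
    obtain ⟨u, hu⟩ := hnonempty w hw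
    obtain ⟨hub, hu0, -⟩ := hs w hw' u hu
    refine (hle w u hu0).trans ?_
    rw [← enorm_eq_nnnorm, ← ofReal_norm]
    refine ENNReal.ofReal_le_ofReal ?_
    have := norm_le_norm_add_norm_sub' u z₀
    rw [mem_ball, dist_eq_norm] at hub
    linarith
  have htop (w) (hw : w ∈ sphere w₀ δ) : r w < ⊤ := (hfin w hw).trans_lt ENNReal.ofReal_lt_top
  refine ⟨htop, ?_⟩
  have hrpos (w) (hw : w ∈ sphere w₀ δ) : ρ < (r w).toReal :=
    (ENNReal.ofReal_lt_iff_lt_toReal hρ.le (htop w hw).ne).1 (hρr w (sphere_subset_closedBall hw))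
  have hrle (w) (hw : w ∈ sphere w₀ δ) : (r w).toReal ≤ ‖z₀‖ + ε :=
    ENNReal.toReal_le_of_le_ofReal (by positivity) (hfin w hw)
  have hsph (t : ℝ) : circleMap w₀ δ t ∈ sphere w₀ δ := circleMap_mem_sphere _ hδ.le _
  -- integrability of `log r`
  have hrint : CircleIntegrable (fun w ↦ Real.log (r w).toReal) w₀ δ := by
    have hmeas : Measurable fun t ↦ r (circleMap w₀ δ t) := by
      refine LowerSemicontinuous.measurable fun t ↦ ?_
      exact (hlsc _ (hcirc t)).comp (continuous_circleMap w₀ δ).continuousAt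
    rw [CircleIntegrable, intervalIntegrable_iff]
    refine IntegrableOn.of_bound measure_Ioc_lt_top
      (Real.measurable_log.comp hmeas.ennreal_toReal).aestronglyMeasurable
      (|Real.log ρ| + |Real.log (‖z₀‖ + ε)|) (.of_forall fun t ↦ ?_)
    have h1 := Real.log_le_log hρ (hrpos _ (hsph t)).le
    have h2 := Real.log_le_log (hρ.trans (hrpos _ (hsph t))) (hrle _ (hsph t))
    rw [Real.norm_eq_abs, abs_le]
    constructor
    · linarith [neg_abs_le (Real.log ρ), abs_nonneg (Real.log (‖z₀‖ + ε))]
    · linarith [le_abs_self (Real.log (‖z₀‖ + ε)), abs_nonneg (Real.log ρ)]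
  -- the harmonic majorant
  set H : ℂ × ℂ → ℂ := fun p ↦ φ p.1 * F p with hH
  have hHan : AnalyticOnNhd ℂ H (sphere z₀ ε ×ˢ closedBall w₀ δ) := by
    rintro ⟨z, w⟩ hp
    exact ((hφan z (sphere_subset_closedBall hp.1)).comp_of_eq
      (f := fun p : ℂ × ℂ ↦ p.1) analyticAt_fst rfl).mul (hFan _ hp)
  set ψ : ℂ → ℂ := fun w ↦ (2 * π * I : ℂ)⁻¹ • ∮ z in C(z₀, ε), H (z, w) with hψ
  have hψeq (w) (hw : w ∈ closedBall w₀ δ) : ψ w = ∑ u ∈ s w, n w u * φ u := by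
    simp only [hψ, hH, hint w hw φ hφan, smul_eq_mul, inv_mul_cancel_left₀ hpi]
  have hψint : CircleIntegrable ψ w₀ δ := by
    refine Continuous.intervalIntegrable ?_ _ _
    exact (continuous_circleIntegral_circleMap hε.le hδ.le (hHan.continuousOn.mono
      (prod_mono_right sphere_subset_closedBall))).const_smul (2 * π * I : ℂ)⁻¹
  have hψ₀ : Real.circleAverage ψ w₀ δ = 0 := by
    rw [hψ, Real.circleAverage_fun_smul, hHan.circleAverage_circleIntegral hε.le hδ]
    change ψ w₀ = 0
    rw [hψeq w₀ hw₀]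
    refine Finset.sum_eq_zero fun u hu ↦ ?_
    obtain ⟨hub, hu0, -⟩ := hs w₀ hw₀ u hu
    simp [hiso u hub hu0, hφ]
  have hψre : Real.circleAverage (fun w ↦ (ψ w).re) w₀ δ = 0 := by
    have := reCLM.circleAverage_comp_comm hψint
    rw [hψ₀] at this
    simpa [Function.comp_def] using this
  have hcomp (w) (hw : w ∈ sphere w₀ δ) :
      Real.log (r w).toReal ≤ Real.log ‖z₀‖ + (m : ℝ)⁻¹ * (ψ w).re := by
    have hw' := sphere_subset_closedBall hw
    have hmR : (0 : ℝ) < m := by exact_mod_cast hm0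
    have key : m * (Real.log (r w).toReal - Real.log ‖z₀‖) ≤ (ψ w).re := by
      rw [hψeq w hw', ← hconst w hw, Complex.re_sum, Int.cast_sum, Finset.sum_mul]
      refine Finset.sum_le_sum fun u hu ↦ ?_
      obtain ⟨hub, hu0, hun⟩ := hs w hw' u hu
      have e : ((n w u : ℂ) * φ u).re = n w u * (φ u).re := by simp
      rw [e, hφre u hub]
      have h1 : (r w).toReal ≤ ‖u‖ := by
        simpa using ENNReal.toReal_mono ENNReal.coe_ne_top (hle w u hu0)
      have h2 := Real.log_le_log (hρ.trans (hrpos w hw)) h1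
      have h3 : (0 : ℝ) < n w u := by exact_mod_cast hun
      gcongr
    rw [inv_mul_eq_div, ← sub_le_iff_le_add', le_div_iff₀ hmR]
    linarith
  have hreint : CircleIntegrable (fun w ↦ (m : ℝ)⁻¹ * (ψ w).re) w₀ δ :=
    (reCLM.integrable_comp hψint.1 |> fun h1 ↦ ⟨h1, reCLM.integrable_comp hψint.2⟩ :
      IntervalIntegrable (fun t ↦ (ψ (circleMap w₀ δ t)).re) volume 0 (2 * π)).const_mul _
  calc Real.circleAverage (fun w ↦ Real.log (r w).toReal) w₀ δ
      ≤ Real.circleAverage (fun w ↦ Real.log ‖z₀‖ + (m : ℝ)⁻¹ * (ψ w).re) w₀ δ := by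
        refine Real.circleAverage_mono hrint ((circleIntegrable_const _ _ _).add hreint) ?_
        rw [abs_of_pos hδ]
        exact hcomp
    _ = Real.log ‖z₀‖ := by
        rw [Real.circleAverage_fun_add (circleIntegrable_const _ _ _) hreint,
          Real.circleAverage_const]
        simp only [← smul_eq_mul (a := (m : ℝ)⁻¹), Real.circleAverage_fun_smul, hψre, smul_zero,
          add_zero]

/-- Super-mean-value inequality for `log r`, where `r w ∈ (0, ∞]` is the smallest
modulus of a zero of the entire function `z ↦ f (z, w)` (`+∞` if there is none),
`f : ℂ × U → ℂ` being holomorphic, `U ⊆ ℂ` open, with `f (0, w) ≠ 0` and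
`z ↦ f (z, w)` not identically zero for each `w ∈ U`: near any point `w₀ ∈ U` with
`r w₀ < ∞`, the average of `log r` over small circles centered at `w₀` is at most
`log (r w₀)`. -/
theorem stmt_7
    (U : Set ℂ) (hU : IsOpen U)
    (f : ℂ × ℂ → ℂ)
    (hf : AnalyticOnNhd ℂ f (Set.univ ×ˢ U))
    (h0 : ∀ w ∈ U, f (0, w) ≠ 0)
    (hnz : ∀ w ∈ U, ∃ z : ℂ, f (z, w) ≠ 0)
    (r : ℂ → ℝ≥0∞)
    (hr : ∀ w, r w = sInf {x : ℝ≥0∞ | ∃ z : ℂ, f (z, w) = 0 ∧ x = (‖z‖₊ : ℝ≥0∞)})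
    (w₀ : ℂ) (hw₀ : w₀ ∈ U) (hfin : r w₀ < ⊤) :
    ∃ δ₀ : ℝ, 0 < δ₀ ∧ ∀ δ : ℝ, 0 < δ → δ < δ₀ →
      Metric.closedBall w₀ δ ⊆ U ∧
      (∀ θ : ℝ, r (w₀ + δ * Complex.exp (θ * Complex.I)) < ⊤) ∧
      (1 / (2 * π)) *
          ∫ θ in (-π)..π, Real.log ((r (w₀ + δ * Complex.exp (θ * Complex.I))).toReal)
        ≤ Real.log ((r w₀).toReal) := by
  have hle (w z) (h : f (z, w) = 0) : r w ≤ ‖z‖₊ := hr w ▸ sInf_le ⟨z, h, rfl⟩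
  have hg : AnalyticOnNhd ℂ (fun z ↦ f (z, w₀)) univ := fun z _ ↦
    (hf (z, w₀) ⟨mem_univ _, hw₀⟩).curry_left
  obtain ⟨z₀, hz₀, hrz₀⟩ := exists_zero_nnnorm_eq_sInf
    (continuousOn_univ.1 hg.continuousOn) (hr w₀ ▸ hfin)
  rw [← hr] at hrz₀
  have hz₀0 : z₀ ≠ 0 := fun h ↦ h0 w₀ hw₀ (h ▸ hz₀)
  have hzpos : 0 < ‖z₀‖ := norm_pos_iff.2 hz₀0
  -- isolate the zero `z₀`
  have hiso : ∀ᶠ z in 𝓝[≠] z₀, f (z, w₀) ≠ 0 := by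
    refine (hg z₀ (mem_univ _)).eventually_eq_zero_or_eventually_ne_zero.resolve_left fun h ↦ ?_
    obtain ⟨z, hz⟩ := hnz w₀ hw₀
    exact hz (hg.eqOn_zero_of_preconnected_of_eventuallyEq_zero isPreconnected_univ
      (mem_univ z₀) h (mem_univ z))
  obtain ⟨η, hη, hηiso⟩ := Metric.eventually_nhds_iff_ball.1 (eventually_nhdsWithin_iff.1 hiso)
  obtain ⟨ε, hε, hεlt⟩ := exists_between (lt_min hη hzpos)
  obtain ⟨hεη, hεz⟩ := lt_min_iff.1 hεlt
  have hne : ∀ᶠ w in 𝓝 w₀, ∀ z ∈ sphere z₀ ε, f (z, w) ≠ 0 := by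
    refine (isCompact_sphere _ _).eventually_forall_of_forall_eventually fun z hz ↦ ?_
    have hc : ContinuousAt (fun p : ℂ × ℂ ↦ f (p.2, p.1)) (w₀, z) :=
      ContinuousAt.comp (f := fun p : ℂ × ℂ ↦ (p.2, p.1))
        (hf (z, w₀) ⟨mem_univ _, hw₀⟩).continuousAt (by fun_prop)
    refine hc.eventually_ne (hηiso z ?_ ?_)
    · rwa [mem_ball, mem_sphere.1 hz]
    · rintro rfl
      simp [hε.ne] at hz
  have hlsc (w) (hw : w ∈ U) : LowerSemicontinuousAt r w :=
    .sInf_nnnorm_zeros hU hf.continuousOn hr hw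
  have hρ : ENNReal.ofReal (‖z₀‖ / 2) < r w₀ := by
    rw [ENNReal.ofReal_lt_iff_lt_toReal (by positivity) hfin.ne, hrz₀]
    simpa using hzpos
  obtain ⟨δ₀, hδ₀, hball⟩ := Metric.eventually_nhds_iff_ball.1
    ((hU.eventually_mem hw₀).and (hne.and (hlsc w₀ hw₀ _ hρ)))
  refine ⟨δ₀, hδ₀, fun δ hδ hδδ₀ ↦ ?_⟩
  have hsub : closedBall w₀ δ ⊆ ball w₀ δ₀ := closedBall_subset_ball hδδ₀
  have hUδ : closedBall w₀ δ ⊆ U := fun w hw ↦ (hball w (hsub hw)).1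
  obtain ⟨htop, havg⟩ := circleAverage_log_smallest_zero_le hf hle hε hδ hεz hz₀
    (fun z hz h ↦ by_contra fun hzz ↦ hηiso z (ball_subset_ball hεη.le hz) hzz h) hUδ
    (fun w hw ↦ (hball w (hsub hw)).2.1) (half_pos hzpos)
    (fun w hw ↦ (hball w (hsub hw)).2.2) (fun w hw ↦ hlsc w (hUδ hw))
  refine ⟨hUδ, fun θ ↦ htop _ (circleMap_mem_sphere _ hδ.le θ), ?_⟩
  have hper := ((periodic_circleMap w₀ δ).comp
    (fun w ↦ Real.log (r w).toReal)).intervalIntegral_add_eq (-π) 0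
  rw [zero_add, show -π + 2 * π = π by ring] at hper
  rw [Real.circleAverage_def, smul_eq_mul] at havg
  simp only [Function.comp_def, circleMap] at hper havg
  rw [hper, one_div, hrz₀]
  simpa using havg
end

section
/- Let D ⊆ ℂ be open and f : ℂ × D → ℂ a holomorphic function such that for every w ∈ D the entire function z ↦ f(z,w) is nonconstant. For w ∈ D let A(w) = {a ∈ ℂ : ∀ z ∈ ℂ, f(z,w) ≠ a} be the set of (finite) exceptional values of z ↦ f(z,w). Then for every w₀ ∈ D and every compact set K ⊆ ℂ with K ∩ A(w₀) = ∅ there exists δ > 0 such that for all w ∈ D with |w − w₀| < δ one has K ∩ A(w) = ∅. -/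
open Filter Topology Metric in
/-- Hurwitz's theorem in open-mapping form: if `f (z₀, w₀) = a` and no slice `z ↦ f (z, w)` is
constant, then `z ↦ f (z, w)` attains every value near `a`, for all `w` near `w₀`. -/
theorem AnalyticOnNhd.eventually_exists_slice_eq {D : Set ℂ} (hD : IsOpen D) {f : ℂ × ℂ → ℂ}
    (hf : AnalyticOnNhd ℂ f (Set.univ ×ˢ D))
    (hnc : ∀ w ∈ D, ∃ z₁ z₂ : ℂ, f (z₁, w) ≠ f (z₂, w)) {w₀ : ℂ} (hw₀ : w₀ ∈ D) (z₀ : ℂ) :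
    ∀ᶠ p : ℂ × ℂ in 𝓝 (w₀, f (z₀, w₀)), ∃ z, f (z, p.1) = p.2 := by
  have hslice : ∀ w ∈ D, AnalyticOnNhd ℂ (fun z => f (z, w)) Set.univ := fun w hw z _ =>
    (hf (z, w) ⟨trivial, hw⟩).comp₂ analyticAt_id analyticAt_const
  have hcont : ∀ z, ∀ w ∈ D, ContinuousAt f (z, w) := fun z w hw =>
    (hf (z, w) ⟨trivial, hw⟩).continuousAt
  have hlocal : ∀ w ∈ D, ¬ ∀ᶠ z in 𝓝 z₀, f (z, w) = f (z₀, w) := by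
    intro w hw h
    obtain ⟨z₁, z₂, hne⟩ := hnc w hw
    have key := (hslice w hw).eqOn_of_preconnected_of_eventuallyEq analyticOnNhd_const
      isPreconnected_univ (Set.mem_univ z₀) h
    exact hne ((key (Set.mem_univ z₁)).trans (key (Set.mem_univ z₂)).symm)
  have hpunct : ∀ᶠ z in 𝓝[≠] z₀, f (z, w₀) ≠ f (z₀, w₀) :=
    ((hslice w₀ hw₀ z₀ trivial).eventually_eq_or_eventually_ne analyticAt_const).resolve_left
      (hlocal w₀ hw₀)
  obtain ⟨R, hR, hball⟩ := Metric.eventually_nhds_iff.mp (eventually_nhdsWithin_iff.mp hpunct)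
  obtain ⟨r, hr, hrR⟩ := exists_between hR
  have hcompact : IsCompact (sphere z₀ r) := isCompact_sphere z₀ r
  have hne : (sphere z₀ r).Nonempty := NormedSpace.sphere_nonempty.mpr hr.le
  have hsc : ContinuousOn (fun z => ‖f (z, w₀) - f (z₀, w₀)‖) (sphere z₀ r) :=
    (((hslice w₀ hw₀).continuousOn.mono (Set.subset_univ _)).sub continuousOn_const).norm
  obtain ⟨x, hx, hmin⟩ := hcompact.exists_isMinOn hne hsc
  have hxpos : 0 < ‖f (x, w₀) - f (z₀, w₀)‖ := by
    refine norm_pos_iff.mpr (sub_ne_zero.mpr (hball ?_ ?_))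
    · rwa [mem_sphere.mp hx]
    · exact ne_of_mem_sphere hx hr.ne'
  obtain ⟨ε, hε, hεx⟩ := exists_between hxpos
  have hsphere : ∀ᶠ w in 𝓝 w₀, ∀ z ∈ sphere z₀ r, ε < ‖f (z, w) - f (z₀, w)‖ := by
    refine hcompact.eventually_forall_of_forall_eventually fun z hz => ?_
    have h1 : ContinuousAt (fun p : ℂ × ℂ => f (p.2, p.1)) (w₀, z) :=
      ContinuousAt.comp (f := fun p : ℂ × ℂ => (p.2, p.1)) (hcont z w₀ hw₀) (by fun_prop)
    have h2 : ContinuousAt (fun p : ℂ × ℂ => f (z₀, p.1)) (w₀, z) :=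
      ContinuousAt.comp (f := fun p : ℂ × ℂ => (z₀, p.1)) (hcont z₀ w₀ hw₀) (by fun_prop)
    exact (h1.sub h2).norm.eventually (lt_mem_nhds (hεx.trans_le (hmin hz)))
  have hclose : ∀ᶠ p : ℂ × ℂ in 𝓝 (w₀, f (z₀, w₀)), ‖p.2 - f (z₀, p.1)‖ < ε / 2 := by
    have h2 : ContinuousAt (fun p : ℂ × ℂ => f (z₀, p.1)) (w₀, f (z₀, w₀)) :=
      ContinuousAt.comp (f := fun p : ℂ × ℂ => (z₀, p.1)) (hcont z₀ w₀ hw₀) (by fun_prop)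
    refine (continuousAt_snd.sub h2).norm.eventually (gt_mem_nhds ?_)
    simpa using hε
  have hfst : Tendsto Prod.fst (𝓝 (w₀, f (z₀, w₀))) (𝓝 w₀) := continuousAt_fst
  filter_upwards [hclose, hfst.eventually hsphere, hfst.eventually (hD.mem_nhds hw₀)]
    with p hp hps hpD
  have hdiff : DiffContOnCl ℂ (fun z => f (z, p.1)) (ball z₀ r) :=
    ((hslice p.1 hpD).differentiableOn.mono (Set.subset_univ _)).diffContOnCl
  obtain ⟨z, -, hz⟩ := hdiff.ball_subset_image_closedBall hr (fun z hz => (hps z hz).le)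
    (not_eventually.mp (hlocal p.1 hpD)) (mem_ball_iff_norm.mpr hp)
  exact ⟨z, hz⟩


/-- Semicontinuity of the set of exceptional values (Proposition 3, entire case):
if `f : ℂ × D → ℂ` is holomorphic, `D ⊆ ℂ` open, and all functions `z ↦ f (z, w)` are
nonconstant, then for every `w₀ ∈ D` and every compact `K ⊆ ℂ` disjoint from the set
`A w₀` of exceptional values of `z ↦ f (z, w₀)`, the set `A w` stays disjoint from `K`
for `w` close to `w₀`. -/
theorem stmt_9
    (D : Set ℂ) (hD : IsOpen D)
    (f : ℂ × ℂ → ℂ)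
    (hf : AnalyticOnNhd ℂ f (Set.univ ×ˢ D))
    (hnc : ∀ w ∈ D, ∃ z₁ z₂ : ℂ, f (z₁, w) ≠ f (z₂, w))
    (A : ℂ → Set ℂ)
    (hA : ∀ w, A w = {a : ℂ | ∀ z : ℂ, f (z, w) ≠ a})
    (w₀ : ℂ) (hw₀ : w₀ ∈ D)
    (K : Set ℂ) (hK : IsCompact K) (hKA : K ∩ A w₀ = ∅) :
    ∃ δ : ℝ, 0 < δ ∧ ∀ w ∈ D, ‖w - w₀‖ < δ → K ∩ A w = ∅ := by
  have hev : ∀ᶠ w in nhds w₀, ∀ a ∈ K, ∃ z, f (z, w) = a := by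
    refine hK.eventually_forall_of_forall_eventually fun a ha => ?_
    have haA : a ∉ A w₀ := fun h => Set.eq_empty_iff_forall_notMem.mp hKA a ⟨ha, h⟩
    rw [hA] at haA
    obtain ⟨z₀, rfl⟩ : ∃ z, f (z, w₀) = a := by simpa using haA
    exact hf.eventually_exists_slice_eq hD hnc hw₀ z₀
  obtain ⟨δ, hδ, h⟩ := Metric.eventually_nhds_iff.mp hev
  refine ⟨δ, hδ, fun w _ hw => Set.eq_empty_iff_forall_notMem.mpr ?_⟩
  rintro a ⟨haK, haA⟩
  rw [hA] at haA
  obtain ⟨z, hz⟩ := h (by rwa [dist_eq_norm]) a haK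
  exact haA z hz
end

section
/- Let D ⊆ ℂ be open and f : ℂ × D → ℂ a holomorphic function such that for every w ∈ D the entire function z ↦ f(z,w) is nonconstant. Let E ⊆ D and a : D → ℂ be such that f(z,w) ≠ a(w) for all w ∈ E and all z ∈ ℂ, and suppose there is M > 0 with ‖a(w)‖ ≤ M for all w ∈ E. Then the restriction of a to E is continuous (a is ContinuousOn E). -/
open Set Filter Topology Metric

/-- A zero-free entire function has an entire logarithm. -/
theorem Complex.exists_entire_log {g : ℂ → ℂ} (hg : Differentiable ℂ g)
    (h0 : ∀ z, g z ≠ 0) : ∃ h : ℂ → ℂ, Differentiable ℂ h ∧ ∀ z, Complex.exp (h z) = g z := by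
  have hd : Differentiable ℂ (deriv g) := fun z => (hg.analyticAt z).deriv.differentiableAt
  obtain ⟨h, hh0, hh⟩ := (hd.div hg h0).isExactOn_univ.with_val_at 0 (Complex.log (g 0))
  have hh' : ∀ z, HasDerivAt h (deriv g z / g z) z := fun z => hh z (mem_univ z)
  have hk : ∀ z, HasDerivAt (fun z => g z * Complex.exp (-h z)) 0 z := fun z => by
    refine ((hg z).hasDerivAt.fun_mul (hh' z).fun_neg.cexp).congr_deriv ?_
    linear_combination -Complex.exp (-h z) * div_mul_cancel₀ (deriv g z) (h0 z)
  have hc : ∀ z, g z * Complex.exp (-h z) = 1 := fun z => by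
    have := is_const_of_deriv_eq_zero (fun z => (hk z).differentiableAt)
      (fun z => (hk z).deriv) z 0
    rw [this, hh0, Complex.exp_neg, Complex.exp_log (h0 0), mul_inv_cancel₀ (h0 0)]
  refine ⟨h, fun z => (hh' z).differentiableAt, fun z => ?_⟩
  have := hc z
  rw [Complex.exp_neg] at this
  field_simp at this
  exact this.symm

/-- An entire function omitting `1` and `-1` is of the form `cos (π G)` with `G` entire. -/
theorem Complex.exists_entire_cos {F : ℂ → ℂ} (hF : Differentiable ℂ F)
    (h1 : ∀ z, F z ≠ 1) (h2 : ∀ z, F z ≠ -1) :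
    ∃ G : ℂ → ℂ, Differentiable ℂ G ∧ ∀ z, F z = Complex.cos (Real.pi * G z) := by
  obtain ⟨h, hd, hh⟩ := Complex.exists_entire_log (g := fun z => 1 - F z ^ 2)
    (by fun_prop) (fun z hz => by
      have : (F z - 1) * (F z + 1) = 0 := by linear_combination -hz
      rcases mul_eq_zero.1 this with h | h
      · exact h1 z (sub_eq_zero.1 h)
      · exact h2 z (eq_neg_of_add_eq_zero_left h))
  have hs : ∀ z, Complex.exp (h z / 2) ^ 2 = 1 - F z ^ 2 := fun z => by
    rw [← hh z, ← Complex.exp_nat_mul]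
    congr 1
    push_cast
    ring
  have hmul : ∀ z, (F z + Complex.I * Complex.exp (h z / 2)) *
      (F z - Complex.I * Complex.exp (h z / 2)) = 1 := fun z => by
    linear_combination hs z - Complex.exp (h z / 2) ^ 2 * Complex.I_sq
  obtain ⟨k, kd, hk⟩ := Complex.exists_entire_log
    (g := fun z => F z + Complex.I * Complex.exp (h z / 2))
    (by fun_prop) (fun z => left_ne_zero_of_mul_eq_one (hmul z))
  refine ⟨fun z => -Complex.I * k z / Real.pi, by fun_prop, fun z => ?_⟩
  have hpi : (Real.pi : ℂ) ≠ 0 := by exact_mod_cast Real.pi_ne_zero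
  have e : (Real.pi : ℂ) * (-Complex.I * k z / Real.pi) = -(k z * Complex.I) := by
    field_simp
  rw [e, Complex.cos_neg, Complex.cos_mul_I, Complex.cosh, Complex.exp_neg, hk z,
    inv_eq_of_mul_eq_one_right (hmul z)]
  ring

/-- Every disc of radius `2` contains a point at which `cos (π z)` is an integer. -/
theorem Complex.exists_cos_pi_mul_eq_intCast (c : ℂ) :
    ∃ z ∈ ball c 2, ∃ m : ℤ, Complex.cos (Real.pi * z) = m := by
  have hcosh : ∀ y : ℝ, 0 ≤ y → ∃ s ∈ Icc y (y + 1), ∃ m : ℤ, Real.cosh (Real.pi * s) = m := by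
    intro y hy
    have hc : Continuous fun s : ℝ => Real.cosh (Real.pi * s) := by fun_prop
    have hpi : 2 ≤ Real.cosh Real.pi := by
      rw [Real.cosh_eq]
      have := Real.quadratic_le_exp_of_nonneg Real.pi_pos.le
      nlinarith [Real.pi_gt_three, Real.exp_pos (-Real.pi)]
    have hgrow : Real.cosh (Real.pi * y) + 1 ≤ Real.cosh (Real.pi * (y + 1)) := by
      rw [mul_add, mul_one, Real.cosh_add]
      have := Real.one_le_cosh (Real.pi * y)
      have h1 : 0 ≤ Real.sinh (Real.pi * y) := Real.sinh_nonneg_iff.2 (by positivity)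
      have h2 : 0 ≤ Real.sinh Real.pi := Real.sinh_nonneg_iff.2 (by positivity)
      nlinarith [mul_nonneg h1 h2]
    obtain ⟨s, hs, he⟩ := intermediate_value_Icc (by linarith : y ≤ y + 1) hc.continuousOn
      (show ((⌈Real.cosh (Real.pi * y)⌉ : ℤ) : ℝ) ∈ _ from
        ⟨Int.le_ceil _, (Int.ceil_lt_add_one _).le.trans hgrow⟩)
    exact ⟨s, hs, _, he⟩
  obtain ⟨t, ht, m, hm⟩ : ∃ t : ℝ, |t - c.im| ≤ 1 ∧ ∃ m : ℤ, Real.cosh (Real.pi * t) = m := by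
    obtain ⟨s, hs, m, hm⟩ := hcosh |c.im| (abs_nonneg _)
    rcases le_total 0 c.im with h | h
    · rw [abs_of_nonneg h] at hs
      exact ⟨s, abs_le.2 ⟨by linarith [hs.1], by linarith [hs.2]⟩, m, hm⟩
    · rw [abs_of_nonpos h] at hs
      refine ⟨-s, abs_le.2 ⟨by linarith [hs.2], by linarith [hs.1]⟩, m, ?_⟩
      rw [mul_neg, Real.cosh_neg, hm]
  refine ⟨(round c.re : ℤ) + t * Complex.I, ?_, (round c.re).negOnePow * m, ?_⟩
  · rw [mem_ball, dist_eq_norm]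
    refine (Complex.norm_le_abs_re_add_abs_im _).trans_lt ?_
    have h1 := abs_sub_round c.re
    rw [abs_sub_comm] at h1
    simp only [Complex.sub_re, Complex.add_re, Complex.intCast_re, Complex.mul_re,
      Complex.ofReal_re, Complex.I_re, mul_zero, Complex.ofReal_im, Complex.I_im, mul_one,
      add_zero, Complex.sub_im, Complex.add_im, Complex.intCast_im, Complex.mul_im,
      zero_add, sub_self]
    linarith
  · have e : (Real.pi : ℂ) * ((round c.re : ℤ) + t * Complex.I) =
        ((Real.pi * t : ℝ) : ℂ) * Complex.I + (round c.re : ℤ) * Real.pi := by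
      push_cast
      ring
    rw [e, Complex.cos_antiperiodic.add_int_mul_eq, Complex.cos_mul_I, ← Complex.ofReal_cosh, hm]
    push_cast
    rfl

/-- If `‖f'‖` is at most twice its value at the centre of a disc, then the image of `f`
contains a disc of controlled radius. -/
theorem Complex.ball_subset_range_of_norm_deriv_le {f : ℂ → ℂ} (hf : Differentiable ℂ f)
    {a : ℂ} {r : ℝ} (hr : 0 < r) (ha : deriv f a ≠ 0)
    (hb : ∀ z ∈ ball a r, ‖deriv f z‖ ≤ 2 * ‖deriv f a‖) :
    ball (f a) (‖deriv f a‖ * r / 24) ⊆ range f := by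
  have hd : Differentiable ℂ (deriv f) := fun z => (hf.analyticAt z).deriv.differentiableAt
  set M := ‖deriv f a‖ with hM
  have hMpos : 0 < M := norm_pos_iff.2 ha
  have hlip : ∀ z ∈ closedBall a (r / 6), ‖deriv f z - deriv f a‖ ≤ M / 2 := by
    intro z hz
    rw [mem_closedBall] at hz
    have := Complex.dist_le_div_mul_dist_of_mapsTo_ball (f := deriv f) (c := a) (R₁ := r)
      (R₂ := 3 * M) (z := z) hd.differentiableOn (fun x hx => by
        rw [mem_closedBall, dist_eq_norm]
        linarith [norm_sub_le (deriv f x) (deriv f a), hb x hx])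
        (by rw [mem_ball]; linarith)
    rw [dist_eq_norm] at this
    refine this.trans ((mul_le_mul_of_nonneg_left hz (by positivity)).trans_eq ?_)
    field_simp
    norm_num
  have hsph : ∀ z ∈ sphere a (r / 6), M * r / 12 ≤ ‖f z - f a‖ := by
    intro z hz
    have hgd : ∀ x, HasDerivAt (fun z => f z - deriv f a * z) (deriv f x - deriv f a) x :=
      fun x => by
        simpa using (hf x).hasDerivAt.fun_sub ((hasDerivAt_id x).const_mul (deriv f a))
    have h := (convex_closedBall a (r / 6)).norm_image_sub_le_of_norm_deriv_le (𝕜 := ℂ)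
      (fun x _ => (hgd x).differentiableAt) (C := M / 2)
      (fun x hx => by rw [(hgd x).deriv]; exact hlip x hx)
      (mem_closedBall_self (by positivity)) (sphere_subset_closedBall hz)
    rw [mem_sphere, dist_eq_norm] at hz
    have h3 : ‖deriv f a * (z - a)‖ ≤ ‖f z - f a‖ +
        ‖f z - deriv f a * z - (f a - deriv f a * a)‖ := by
      refine le_of_eq_of_le ?_ (norm_sub_le _ _)
      congr 1
      ring
    rw [norm_mul, ← hM, hz] at h3
    rw [hz] at h
    linarith
  have := hf.diffContOnCl.ball_subset_image_closedBall (by positivity : 0 < r / 6) hsph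
    (((hf a).hasDerivAt.eventually_ne ha).frequently.filter_mono nhdsWithin_le_nhds)
  refine (Subset.trans (ball_subset_ball ?_) this).trans (image_subset_range _ _)
  linarith

/-- A consequence of Bloch's theorem: the image of a nonconstant entire function contains discs
of arbitrarily large radius. -/
theorem Complex.exists_ball_subset_range {f : ℂ → ℂ} (hf : Differentiable ℂ f)
    {z₀ : ℂ} (h0 : deriv f z₀ ≠ 0) {ρ : ℝ} (hρ : 0 < ρ) : ∃ c, ball c ρ ⊆ range f := by
  have hd : Differentiable ℂ (deriv f) := fun z => (hf.analyticAt z).deriv.differentiableAt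
  have hN : 0 < ‖deriv f z₀‖ := norm_pos_iff.2 h0
  set R := 48 * ρ / ‖deriv f z₀‖ with hR
  have hRpos : 0 < R := by positivity
  have hRN : ‖deriv f z₀‖ * R = 48 * ρ := by rw [hR]; field_simp
  have hdc := hd.continuous
  obtain ⟨p, hp, hmax⟩ := (isCompact_closedBall z₀ R).exists_isMaxOn
    ⟨z₀, mem_closedBall_self hRpos.le⟩
    (f := fun z => ‖deriv f z‖ * (R - dist z z₀)) (by fun_prop)
  have hge : 48 * ρ ≤ ‖deriv f p‖ * (R - dist p z₀) := by
    have := hmax (mem_closedBall_self hRpos.le)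
    simp only [mem_ofPred_eq, dist_self, sub_zero, hRN] at this
    exact this
  have hpR : 0 ≤ R - dist p z₀ := sub_nonneg.2 hp
  have hprod : 0 < ‖deriv f p‖ * (R - dist p z₀) := by linarith
  have hR' : 0 < R - dist p z₀ := pos_of_mul_pos_right hprod (norm_nonneg _)
  have hp' : 0 < ‖deriv f p‖ := pos_of_mul_pos_left hprod hpR
  refine ⟨f p, (ball_subset_ball ?_).trans
    (Complex.ball_subset_range_of_norm_deriv_le hf (r := (R - dist p z₀) / 2) (by positivity)
      (norm_pos_iff.1 hp') fun z hz => ?_)⟩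
  · linarith
  · rw [mem_ball] at hz
    have htri := dist_triangle z p z₀
    have := hmax (show z ∈ closedBall z₀ R by rw [mem_closedBall]; linarith)
    simp only [mem_ofPred_eq] at this
    have h2 : ‖deriv f z‖ * ((R - dist p z₀) / 2) ≤ ‖deriv f z‖ * (R - dist z z₀) :=
      mul_le_mul_of_nonneg_left (by linarith) (norm_nonneg _)
    refine le_of_mul_le_mul_right ?_ hR'
    linarith

/-- **Little Picard theorem**: an entire function omitting two distinct values is constant. -/
theorem Complex.apply_eq_apply_of_omits_two {f : ℂ → ℂ} (hf : Differentiable ℂ f)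
    {a b : ℂ} (hab : a ≠ b) (ha : ∀ z, f z ≠ a) (hb : ∀ z, f z ≠ b) (x y : ℂ) : f x = f y := by
  have hba : b - a ≠ 0 := sub_ne_zero.2 hab.symm
  obtain ⟨G, hG, hFG⟩ := Complex.exists_entire_cos
    (F := fun z => (2 * f z - a - b) / (b - a)) (by fun_prop)
    (fun z hz => hb z (by
      rw [div_eq_iff hba] at hz
      linear_combination hz / 2))
    (fun z hz => ha z (by
      rw [div_eq_iff hba] at hz
      linear_combination hz / 2))
  have hGint : ∀ z (m : ℤ), G z ≠ m := fun z m hm => by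
    have h := hFG z
    have hsin : Complex.sin (Real.pi * G z) = 0 := by
      rw [hm, mul_comm]
      exact Complex.sin_int_mul_pi m
    have h1 := Complex.sin_sq_add_cos_sq (Real.pi * G z)
    rw [hsin, ← h, div_pow] at h1
    field_simp at h1
    have h2 : (f z - a) * (f z - b) = 0 := by linear_combination h1 / 4
    rcases mul_eq_zero.1 h2 with h | h
    · exact ha z (sub_eq_zero.1 h)
    · exact hb z (sub_eq_zero.1 h)
  obtain ⟨H, hH, hGH⟩ := Complex.exists_entire_cos hG
    (fun z => by simpa using hGint z 1) (fun z => by simpa using hGint z (-1))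
  have hH0 : ∀ z, deriv H z = 0 := by
    by_contra! hne
    obtain ⟨z, hz⟩ := hne
    obtain ⟨c, hc⟩ := Complex.exists_ball_subset_range hH hz two_pos
    obtain ⟨u, hu, m, hm⟩ := Complex.exists_cos_pi_mul_eq_intCast c
    obtain ⟨v, rfl⟩ := hc hu
    exact hGint v m ((hGH v).trans hm)
  have h := hFG x
  rw [hGH x, is_const_of_deriv_eq_zero hH hH0 x y, ← hGH y, ← hFG y, div_left_inj' hba] at h
  linear_combination h / 2

/-- A nonconstant entire function takes any given value only at isolated points. -/
theorem Complex.eventually_nhdsNE_ne {g : ℂ → ℂ} (hg : Differentiable ℂ g)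
    (hnc : ∃ z₁ z₂, g z₁ ≠ g z₂) (z₀ b : ℂ) : ∀ᶠ z in 𝓝[≠] z₀, g z ≠ b := by
  refine ((hg.analyticAt z₀).eventually_eq_or_eventually_ne analyticAt_const).resolve_left
    fun h => ?_
  obtain ⟨z₁, z₂, hne⟩ := hnc
  have := AnalyticOnNhd.eq_of_eventuallyEq (f := g) (g := fun _ => b)
    (fun z _ => hg.analyticAt z) (fun z _ => analyticAt_const) h
  exact hne (by rw [this])

/-- Hurwitz-type stability: a value attained by `f (·, w)` has a neighbourhood of values which
are attained by `f (·, w')` for all `w'` close to `w`. -/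
theorem AnalyticOnNhd.eventually_mem_range_slice {D : Set ℂ} (hD : IsOpen D) {f : ℂ × ℂ → ℂ}
    (hf : AnalyticOnNhd ℂ f (univ ×ˢ D)) (hnc : ∀ w ∈ D, ∃ z₁ z₂ : ℂ, f (z₁, w) ≠ f (z₂, w))
    {w : ℂ} (hw : w ∈ D) (z₀ : ℂ) :
    ∃ δ > 0, ∀ᶠ w' in 𝓝 w, ball (f (z₀, w)) δ ⊆ range fun z => f (z, w') := by
  have hslice : ∀ w ∈ D, Differentiable ℂ fun z => f (z, w) := fun w hw z =>
    DifferentiableAt.comp (g := f) (f := fun z => (z, w)) z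
      (hf (z, w) ⟨mem_univ _, hw⟩).differentiableAt (by fun_prop)
  obtain ⟨r, hr, hball⟩ := Metric.eventually_nhds_iff.1 (eventually_nhdsWithin_iff.1
    (Complex.eventually_nhdsNE_ne (hslice w hw) (hnc w hw) z₀ (f (z₀, w))))
  have hr2 : 0 < r / 2 := by positivity
  obtain ⟨p, hp, hmin⟩ := (isCompact_sphere z₀ (r / 2)).exists_isMinOn
    (NormedSpace.sphere_nonempty.2 hr2.le) (f := fun z => ‖f (z, w) - f (z₀, w)‖)
    (((hslice w hw).continuous.sub continuous_const).norm.continuousOn)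
  set ε := ‖f (p, w) - f (z₀, w)‖ with hε
  have hεpos : 0 < ε := by
    rw [mem_sphere] at hp
    refine norm_pos_iff.2 (sub_ne_zero.2 (hball (by linarith) ?_))
    rintro rfl
    simp only [dist_self] at hp
    linarith
  have hunif : ∀ᶠ w' in 𝓝 w, ∀ z ∈ closedBall z₀ (r / 2), ‖f (z, w') - f (z, w)‖ < ε / 8 := by
    refine (isCompact_closedBall z₀ (r / 2)).eventually_forall_of_forall_eventually fun z _ => ?_
    have hc1 : Tendsto (fun q : ℂ × ℂ => f (q.2, q.1)) (𝓝 (w, z)) (𝓝 (f (z, w))) :=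
      (hf (z, w) ⟨mem_univ _, hw⟩).continuousAt.tendsto.comp
        (continuous_swap.tendsto (w, z))
    have hc2 : Tendsto (fun q : ℂ × ℂ => f (q.2, w)) (𝓝 (w, z)) (𝓝 (f (z, w))) :=
      ((hslice w hw).continuous.comp continuous_snd).tendsto (w, z)
    have := (hc1.sub hc2).norm
    rw [sub_self, norm_zero] at this
    exact this.eventually (gt_mem_nhds (by positivity))
  refine ⟨ε / 4, by positivity, ?_⟩
  filter_upwards [hunif, hD.mem_nhds hw] with w' hw' hD'
  have h0 := hw' z₀ (mem_closedBall_self hr2.le)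
  have hsub := (hslice w' hD').diffContOnCl.ball_subset_image_closedBall hr2
    (ε := 3 * ε / 4) (fun z hz => by
      have h1 := hw' z (sphere_subset_closedBall hz)
      have h2 : ε ≤ ‖f (z, w) - f (z₀, w)‖ := hmin hz
      have h3 : ‖f (z, w) - f (z₀, w)‖ ≤ ‖f (z, w') - f (z₀, w')‖ +
          ‖f (z, w') - f (z, w)‖ + ‖f (z₀, w') - f (z₀, w)‖ := by
        refine le_of_eq_of_le ?_ (norm_add_le_of_le (norm_sub_le (f (z, w') - f (z₀, w'))
          (f (z, w') - f (z, w))) le_rfl)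
        congr 1
        ring
      linarith)
    ((Complex.eventually_nhdsNE_ne (hslice w' hD') (hnc w' hD') z₀ _).frequently.filter_mono
      nhdsWithin_le_nhds)
  refine (Subset.trans (ball_subset_ball' ?_) hsub).trans (image_subset_range _ _)
  rw [dist_comm, dist_eq_norm]
  linarith

/-- Corollary 2 of Proposition 3: if `f : ℂ × D → ℂ` is holomorphic, `D ⊆ ℂ` open, all
functions `z ↦ f (z, w)` nonconstant, and `a : D → ℂ` is a bounded-on-`E` selection of
exceptional values (`f (z, w) ≠ a w` for `w ∈ E`), then `a` is continuous on `E`. -/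
theorem stmt_10
    (D : Set ℂ) (hD : IsOpen D)
    (f : ℂ × ℂ → ℂ)
    (hf : AnalyticOnNhd ℂ f (Set.univ ×ˢ D))
    (hnc : ∀ w ∈ D, ∃ z₁ z₂ : ℂ, f (z₁, w) ≠ f (z₂, w))
    (E : Set ℂ) (hE : E ⊆ D)
    (a : ℂ → ℂ)
    (ha : ∀ w ∈ E, ∀ z : ℂ, f (z, w) ≠ a w)
    (M : ℝ) (hM : 0 < M) (hbd : ∀ w ∈ E, ‖a w‖ ≤ M) :
    ContinuousOn a E := by
  intro w hw
  refine (isCompact_closedBall (0 : ℂ) M).le_nhds_of_unique_clusterPt ?_ fun b _ hb => ?_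
  · refine mem_map.2 (mem_of_superset self_mem_nhdsWithin fun w' hw' => ?_)
    simpa using hbd w' hw'
  by_contra hne
  obtain ⟨z₀, rfl⟩ : ∃ z₀, f (z₀, w) = b := by
    by_contra! hom
    have hslice : Differentiable ℂ fun z => f (z, w) := fun z =>
      DifferentiableAt.comp (g := f) (f := fun z => (z, w)) z
        (hf (z, w) ⟨mem_univ _, hE hw⟩).differentiableAt (by fun_prop)
    obtain ⟨z₁, z₂, h⟩ := hnc w (hE hw)
    exact h (Complex.apply_eq_apply_of_omits_two hslice hne hom (ha w hw) z₁ z₂)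
  obtain ⟨δ, hδ, hev⟩ := hf.eventually_mem_range_slice hD hnc (hE hw) z₀
  have hfreq : ∃ᶠ w' in 𝓝[E] w, a w' ∈ ball (f (z₀, w)) δ :=
    mapClusterPt_iff_frequently.1 hb _ (ball_mem_nhds _ hδ)
  obtain ⟨w', ⟨hb', hr'⟩, hE'⟩ :=
    ((hfreq.and_eventually (hev.filter_mono nhdsWithin_le_nhds)).and_eventually
      self_mem_nhdsWithin).exists
  obtain ⟨z, hz⟩ := hr' hb'
  exact ha w' hE' z hz
end
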